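/- arXiv:2604.23682 — 2 statements merged into one kernel-verified Lean document; each statement's English description precedes it below -/
import Mathlib

section
/- Assume the origin is a singular point. Then ε(t) := sup_{1/2 ≤ |x| ≤ 1} |∇R_t(x)| tends to 0 as t → ∞. -/
open MeasureTheory Metric Filter Topology Pointwise

noncomputable section

abbrev En (n : ℕ) := EuclideanSpace ℝ (Fin n)

/-- symmetric trace-free matrices -/
def S0 {n : ℕ} (B : Matrix (Fin n) (Fin n) ℝ) : Prop := B.IsSymm ∧ B.trace = 0

/-- ψ_B(x) = (1/2) x·Bx -/
def psiM {n : ℕ} (B : Matrix (Fin n) (Fin n) ℝ) (x : En n) : ℝ :=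
  (1/2) * ∑ i, ∑ j, B i j * x i * x j

/-- p₀(x) = |x|²/(2n) -/
def p0 (n : ℕ) (x : En n) : ℝ := ‖x‖^2 / (2*n)

/-- q_B = p₀ + ψ_B -/
def qB {n : ℕ} (B : Matrix (Fin n) (Fin n) ℝ) (x : En n) : ℝ := p0 n x + psiM B x

/-- surface measure on the unit sphere -/
def sphMeas (n : ℕ) : Measure (En n) :=
  (Measure.hausdorffMeasure ((n:ℝ) - 1)).restrict (sphere (0:En n) 1)

/-- total surface area of the unit sphere -/
def sphArea (n : ℕ) : ℝ := (sphMeas n Set.univ).toReal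

/-- u is a C^{1,1} solution of Δu = χ_{|∇u|>0} in B₁ with 0 a free boundary point. -/
def SolutionHyp {n : ℕ} (u : En n → ℝ) : Prop :=
  (∀ x ∈ ball (0:En n) 1, DifferentiableAt ℝ u x) ∧
  (∃ L : NNReal, LipschitzOnWith L (fun x => gradient u x) (ball (0:En n) 1)) ∧
  (∀ᵐ x ∂(volume.restrict (ball (0:En n) 1)),
      ∃ D : En n →L[ℝ] En n, HasFDerivAt (fun y => gradient u y) D x ∧
        ((gradient u x = 0 → LinearMap.trace ℝ (En n) (D : En n →ₗ[ℝ] En n) = 0) ∧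
         (gradient u x ≠ 0 → LinearMap.trace ℝ (En n) (D : En n →ₗ[ℝ] En n) = 1))) ∧
  ((0:En n) ∈ frontier {x | x ∈ ball (0:En n) 1 ∧ gradient u x ≠ 0}) ∧
  gradient u 0 = 0

/-- the quadratic rescaling u_t(x) = e^{2t}(u(e^{-t}x)-u(0)) -/
def ut {n : ℕ} (u : En n → ℝ) (t : ℝ) (x : En n) : ℝ :=
  Real.exp (2*t) * (u (Real.exp (-t) • x) - u 0)

/-- Λ = {x ∈ B₁ : ∇u(x)=0} -/
def Lam {n : ℕ} (u : En n → ℝ) : Set (En n) :=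
  {x | x ∈ ball (0:En n) 1 ∧ gradient u x = 0}

/-- Λ_t = e^t Λ -/
def LamT {n : ℕ} (u : En n → ℝ) (t : ℝ) : Set (En n) := Real.exp t • Lam u

/-- B(t) is the L²(∂B₁)-projection coefficient of u_t - p₀ -/
def BProp {n : ℕ} (u : En n → ℝ) (B : ℝ → Matrix (Fin n) (Fin n) ℝ) : Prop :=
  ∀ t, 0 < t → S0 (B t) ∧
    ∀ C, S0 C →
      ∫ x, (ut u t x - p0 n x - psiM (B t) x) * psiM C x ∂(sphMeas n) = 0

/-- remainder R_t = u_t - q_{B(t)} -/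
def Rt {n : ℕ} (u : En n → ℝ) (B : ℝ → Matrix (Fin n) (Fin n) ℝ) (t : ℝ) (x : En n) : ℝ :=
  ut u t x - qB (B t) x

/-- F(t) = ∫_{Λ_t ∩ B₁} |x|² dx -/
def Fdef {n : ℕ} (u : En n → ℝ) (t : ℝ) : ℝ :=
  ∫ x in LamT u t ∩ ball (0:En n) 1, ‖x‖^2

/-- I(t) = ∫_{Λ_t ∩ B₁} x·∇R_t dx -/
def Idef {n : ℕ} (u : En n → ℝ) (B : ℝ → Matrix (Fin n) (Fin n) ℝ) (t : ℝ) : ℝ :=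
  ∫ x in LamT u t ∩ ball (0:En n) 1, ∑ i, x i * gradient (Rt u B t) x i

/-- the origin is a singular point -/
def IsSingular {n : ℕ} (u : En n → ℝ) : Prop :=
  ∃ (r : ℕ → ℝ) (Bstar : Matrix (Fin n) (Fin n) ℝ),
    (∀ k, 0 < r k) ∧ Tendsto r atTop (nhds 0) ∧ S0 Bstar ∧
    (∀ K : Set (En n), IsCompact K →
      TendstoUniformlyOn (fun k x => (u (r k • x) - u 0) / (r k)^2) (qB Bstar) atTop K ∧
      TendstoUniformlyOn (fun k x => gradient (fun y => (u (r k • y) - u 0) / (r k)^2) x)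
        (fun x => gradient (qB Bstar) x) atTop K)

/-- Frobenius norm -/
def frob {n : ℕ} (M : Matrix (Fin n) (Fin n) ℝ) : ℝ := Real.sqrt (∑ i, ∑ j, (M i j)^2)

/-- the annulus 1/2 < |x| < 1 -/
def ann0 (n : ℕ) : Set (En n) := {x | 1/2 < ‖x‖ ∧ ‖x‖ < 1}

/-- the dyadic annulus 2^{-k-1} < |x| < 2^{-k} -/
def annK (n : ℕ) (k : ℕ) : Set (En n) :=
  {x | (2:ℝ)^(-(k:ℤ)-1) < ‖x‖ ∧ ‖x‖ < (2:ℝ)^(-(k:ℤ))}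

def F0 {n : ℕ} (u : En n → ℝ) (t : ℝ) : ℝ := ∫ x in LamT u t ∩ ann0 n, ‖x‖^2

def Fk {n : ℕ} (u : En n → ℝ) (k : ℕ) (t : ℝ) : ℝ := ∫ x in LamT u t ∩ annK n k, ‖x‖^2

def I0 {n : ℕ} (u : En n → ℝ) (B : ℝ → Matrix (Fin n) (Fin n) ℝ) (t : ℝ) : ℝ :=
  ∫ x in LamT u t ∩ ann0 n, ∑ i, x i * gradient (Rt u B t) x i

def Ik {n : ℕ} (u : En n → ℝ) (B : ℝ → Matrix (Fin n) (Fin n) ℝ) (k : ℕ) (t : ℝ) : ℝ :=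
  ∫ x in LamT u t ∩ annK n k, ∑ i, x i * gradient (Rt u B t) x i

/-- ε(t) = sup_{1/2 ≤ |x| ≤ 1} |∇R_t(x)| -/
def epsd {n : ℕ} (u : En n → ℝ) (B : ℝ → Matrix (Fin n) (Fin n) ℝ) (t : ℝ) : ℝ :=
  ⨆ x ∈ {x : En n | 1/2 ≤ ‖x‖ ∧ ‖x‖ ≤ 1}, ‖gradient (Rt u B t) x‖

/-- trace-free part of a matrix -/
def tf {n : ℕ} (M : Matrix (Fin n) (Fin n) ℝ) : Matrix (Fin n) (Fin n) ℝ :=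
  Matrix.of fun i j => M i j - (M.trace / n) * (if i = j then 1 else 0)

/-- second moment matrix of Λ_t ∩ B₁ -/
def momMat {n : ℕ} (u : En n → ℝ) (t : ℝ) : Matrix (Fin n) (Fin n) ℝ :=
  Matrix.of fun i j => ∫ x in LamT u t ∩ ball (0:En n) 1, x i * x j

/-- V(t) -/
def Vdef {n : ℕ} (u : En n → ℝ) (t : ℝ) : ℝ :=
  ∑' k : ℕ, (2:ℝ)^(-((k * (n+2) : ℕ) : ℤ)) * F0 u (t + k * Real.log 2) *
    ∫ τ in t..(t + k * Real.log 2), Fdef u τ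

/-- Lipschitz functions that vanish off the open unit ball. -/
def LipInBall {n : ℕ} {F : Type*} [NormedAddCommGroup F] (f : En n → F) : Prop :=
  (∃ C, LipschitzWith C f) ∧ ∀ x, 1 ≤ ‖x‖ → f x = 0

/-- The divergence of a vector field. -/
def diverg {n : ℕ} (Y : En n → En n) (x : En n) : ℝ :=
  LinearMap.trace ℝ (En n) (fderiv ℝ Y x : En n →ₗ[ℝ] En n)

theorem integrable_of_bounded_of_zero_off_ball {n : ℕ} {F : Type*} [NormedAddCommGroup F]
    {f : En n → F} (C : ℝ) (hm : AEStronglyMeasurable f volume)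
    (hb : ∀ᵐ x, ‖x‖ ≤ 1 → ‖f x‖ ≤ C) (h0 : ∀ x, 1 < ‖x‖ → f x = 0) : Integrable f := by
  have h : IntegrableOn f (closedBall 0 1) := by
    refine Measure.integrableOn_of_bounded (M := C) measure_closedBall_lt_top.ne hm ?_
    rw [ae_restrict_iff' measurableSet_closedBall]
    filter_upwards [hb] with x hx hx1
    exact hx (by simpa using hx1)
  refine (integrableOn_iff_integrable_of_support_subset ?_).1 h
  intro x hx
  by_contra hc
  exact hx (h0 x (by simpa using hc))

theorem LipInBall.exists_bound {n : ℕ} {F : Type*} [NormedAddCommGroup F] {η : En n → F}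
    (hη : LipInBall η) : ∃ C, 0 ≤ C ∧ ∀ x, ‖η x‖ ≤ C := by
  obtain ⟨⟨K, hK⟩, h0⟩ := hη
  refine ⟨‖η 0‖ + K, by positivity, fun x => ?_⟩
  rcases le_or_gt 1 ‖x‖ with h | h
  · rw [h0 x h, norm_zero]; positivity
  · have := hK.norm_sub_le x 0
    have h2 : ‖η x‖ ≤ ‖η x - η 0‖ + ‖η 0‖ := by simpa using norm_add_le (η x - η 0) (η 0)
    have h3 : (K : ℝ) * ‖x - 0‖ ≤ K := by
      rw [sub_zero]; exact mul_le_of_le_one_right K.2 h.le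
    linarith

/-- A bilinear expression in a Lipschitz function supported in the ball and a Lipschitz function
is again Lipschitz and supported in the ball. -/
theorem LipInBall.bilin {n : ℕ} {F G H : Type*} [NormedAddCommGroup F] [NormedAddCommGroup G]
    [NormedAddCommGroup H] {η : En n → F} (hη : LipInBall η) {f : En n → G} {C : NNReal}
    (hf : LipschitzWith C f) (op : F → G → H) (hl : ∀ a a' b, op (a - a') b = op a b - op a' b)
    (hr : ∀ a b b', op a (b - b') = op a b - op a b') (hop : ∀ a b, ‖op a b‖ ≤ ‖a‖ * ‖b‖) :
    LipInBall (fun x => op (η x) (f x)) := by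
  have hz : ∀ b, op 0 b = 0 := fun b => by simpa using hl 0 0 b
  obtain ⟨M, hM, hb⟩ := hη.exists_bound
  obtain ⟨⟨K, hK⟩, h0⟩ := hη
  refine ⟨⟨(⟨M, hM⟩ * C + K * (‖f 0‖₊ + C)), ?_⟩, fun x hx => by simp [h0 x hx, hz]⟩
  have hfb : ∀ y : En n, ‖y‖ < 1 → ‖f y‖ ≤ ‖f 0‖ + C := by
    intro y hy
    have := hf.norm_sub_le y 0
    have h2 : ‖f y‖ ≤ ‖f y - f 0‖ + ‖f 0‖ := by simpa using norm_add_le (f y - f 0) (f 0)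
    have h3 : (C : ℝ) * ‖y - 0‖ ≤ C := by
      rw [sub_zero]; exact mul_le_of_le_one_right C.2 hy.le
    linarith
  have key : ∀ x y : En n, ‖y‖ < 1 → ‖op (η x) (f x) - op (η y) (f y)‖ ≤
      (M * C + K * (‖f 0‖ + C)) * ‖x - y‖ := by
    intro x y hy
    have e : op (η x) (f x) - op (η y) (f y) =
        op (η x) (f x - f y) + op (η x - η y) (f y) := by
      rw [hr, hl]; abel
    rw [e]
    calc _ ≤ ‖η x‖ * ‖f x - f y‖ + ‖η x - η y‖ * ‖f y‖ :=
          (norm_add_le _ _).trans (add_le_add (hop _ _) (hop _ _))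
      _ ≤ M * (C * ‖x - y‖) + (K * ‖x - y‖) * (‖f 0‖ + C) := by
          gcongr
          · exact hb x
          · exact hf.norm_sub_le x y
          · exact hK.norm_sub_le x y
          · exact hfb y hy
      _ = _ := by ring
  refine LipschitzWith.of_dist_le_mul fun x y => ?_
  rw [dist_eq_norm, dist_eq_norm]
  have hc : ((⟨M, hM⟩ * C + K * (‖f 0‖₊ + C) : NNReal) : ℝ) = M * C + K * (‖f 0‖ + C) := by
    push_cast; rfl
  rw [hc]
  rcases lt_or_ge ‖y‖ 1 with hy | hy
  · exact key x y hy
  rcases lt_or_ge ‖x‖ 1 with hx | hx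
  · have := key y x hx
    rwa [norm_sub_rev, norm_sub_rev y x] at this
  · rw [h0 x hx, h0 y hy, hz, hz, sub_zero, norm_zero]
    positivity

theorem LipInBall.smul {n : ℕ} {F : Type*} [NormedAddCommGroup F] [NormedSpace ℝ F]
    {η : En n → ℝ} (hη : LipInBall η) {f : En n → F} {C : NNReal} (hf : LipschitzWith C f) :
    LipInBall (fun x => η x • f x) :=
  hη.bilin hf (fun a b => a • b) (fun _ _ _ => sub_smul _ _ _) (fun _ _ _ => smul_sub _ _ _)
    fun _ _ => (norm_smul _ _).le

theorem LipInBall.inner_lip {n m : ℕ} {η : En n → En m} (hη : LipInBall η) {f : En n → En m}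
    {C : NNReal} (hf : LipschitzWith C f) : LipInBall (fun x => inner ℝ (η x) (f x)) :=
  hη.bilin hf (fun a b => inner ℝ a b) (fun _ _ _ => inner_sub_left _ _ _)
    (fun _ _ _ => inner_sub_right _ _ _) fun _ _ => norm_inner_le_norm _ _

theorem LipInBall.sub {n : ℕ} {F : Type*} [NormedAddCommGroup F] {f g : En n → F}
    (hf : LipInBall f) (hg : LipInBall g) : LipInBall (fun x => f x - g x) := by
  obtain ⟨⟨C, hC⟩, hf0⟩ := hf
  obtain ⟨⟨D, hD⟩, hg0⟩ := hg
  exact ⟨⟨C + D, hC.sub hD⟩, fun x hx => by simp [hf0 x hx, hg0 x hx]⟩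

theorem LipInBall.hasCompactSupport {n : ℕ} {F : Type*} [NormedAddCommGroup F] {f : En n → F}
    (hf : LipInBall f) : HasCompactSupport f := by
  refine HasCompactSupport.intro (isCompact_closedBall 0 1) fun x hx => hf.2 x ?_
  have : 1 < ‖x‖ := by simpa using hx
  exact this.le

theorem LipInBall.integral_fderiv_eq_zero {n : ℕ} {f : En n → ℝ} (hf : LipInBall f) (e : En n) :
    ∫ x, fderiv ℝ f x e = 0 := by
  obtain ⟨C, hC⟩ := hf.1
  have h1 := LipschitzWith.integral_lineDeriv_mul_eq (μ := volume)
    (LipschitzWith.const (1 : ℝ) : LipschitzWith 0 (fun _ : En n => (1 : ℝ))) hC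
    hf.hasCompactSupport (-e)
  rw [neg_neg] at h1
  have h2 : ∫ x, fderiv ℝ f x e = ∫ x, lineDeriv ℝ f x e * 1 := by
    refine integral_congr_ae ?_
    filter_upwards [hC.ae_differentiableAt] with x hx
    rw [mul_one, hx.lineDeriv_eq_fderiv]
  rw [h2, ← h1]
  simp [lineDeriv]

theorem LipInBall.fderiv_zero_off {n : ℕ} {F : Type*} [NormedAddCommGroup F] [NormedSpace ℝ F]
    {f : En n → F} (hf : LipInBall f) {x : En n} (hx : 1 < ‖x‖) : fderiv ℝ f x = 0 := by
  have : f =ᶠ[𝓝 x] fun _ => 0 := by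
    filter_upwards [(isOpen_lt continuous_const continuous_norm).mem_nhds hx] with y hy
    exact hf.2 y (le_of_lt hy)
  rw [this.fderiv_eq]
  simp

/-- The divergence theorem for a Lipschitz field supported in the unit ball. -/
theorem LipInBall.integral_diverg_eq_zero {n : ℕ} {Y : En n → En n} (hY : LipInBall Y) :
    ∫ x, diverg Y x = 0 := by
  obtain ⟨C, hC⟩ := hY.1
  have hcomp : ∀ i : Fin n, LipInBall (fun x => Y x i) := fun i =>
    ⟨⟨C, LipschitzWith.of_dist_le_mul fun x y => by
      refine le_trans ?_ (hC.dist_le_mul x y)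
      rw [dist_eq_norm, dist_eq_norm, ← PiLp.sub_apply]
      exact PiLp.norm_apply_le (Y x - Y y) i⟩, fun x hx => by simp [hY.2 x hx]⟩
  have e1 : ∫ x, diverg Y x =
      ∫ x, ∑ i, fderiv ℝ (fun x => Y x i) x (EuclideanSpace.single i 1) := by
    refine integral_congr_ae ?_
    filter_upwards [hC.ae_differentiableAt] with x hx
    rw [diverg, LinearMap.trace_eq_sum_inner _ (EuclideanSpace.basisFun (Fin n) ℝ)]
    refine Finset.sum_congr rfl fun i _ => ?_
    have h : HasFDerivAt (fun x => Y x i) ((EuclideanSpace.proj i).comp (fderiv ℝ Y x)) x :=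
      (EuclideanSpace.proj (𝕜 := ℝ) i).hasFDerivAt.comp x hx.hasFDerivAt
    rw [h.fderiv]
    simp [EuclideanSpace.inner_single_left]
  rw [e1, integral_finsetSum]
  · exact Finset.sum_eq_zero fun i _ => (hcomp i).integral_fderiv_eq_zero _
  · intro i _
    obtain ⟨K, hK⟩ := (hcomp i).1
    refine integrable_of_bounded_of_zero_off_ball (K * ‖EuclideanSpace.single i (1 : ℝ)‖)
      (measurable_fderiv_apply_const ℝ _ _).aestronglyMeasurable
      (Eventually.of_forall fun x _ => ?_) fun x hx => ?_
    · exact (ContinuousLinearMap.le_opNorm _ _).trans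
        (mul_le_mul_of_nonneg_right (norm_fderiv_le_of_lipschitz ℝ hK) (norm_nonneg _))
    · rw [(hcomp i).fderiv_zero_off hx]; rfl

/-- A smooth radially decreasing function supported in the unit ball. -/
def bumpPhi {n : ℕ} (x : En n) : ℝ := expNegInvGlue (1 - ‖x‖ ^ 2)

/-- The radial weight with `∇ bumpPhi x = - bumpRho x • x`. -/
def bumpRho {n : ℕ} (x : En n) : ℝ := 2 * deriv expNegInvGlue (1 - ‖x‖ ^ 2)

theorem contDiff_deriv_expNegInvGlue {m : ℕ} : ContDiff ℝ m (deriv expNegInvGlue) := by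
  have h : ContDiff ℝ ((m + 1 : ℕ) : ℕ∞) expNegInvGlue := expNegInvGlue.contDiff
  have h' : ContDiff ℝ ((m : WithTop ℕ∞) + 1) expNegInvGlue := by exact_mod_cast h
  exact (contDiff_succ_iff_deriv.1 h').2.2

theorem bumpPhi_contDiff {n : ℕ} : ContDiff ℝ 2 (bumpPhi (n := n)) := by
  have h : ContDiff ℝ ((2 : ℕ) : ℕ∞) expNegInvGlue := expNegInvGlue.contDiff
  exact (show ContDiff ℝ 2 expNegInvGlue by exact_mod_cast h).comp
    (contDiff_const.sub (contDiff_norm_sq ℝ))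

theorem bumpRho_contDiff {n : ℕ} : ContDiff ℝ 2 (bumpRho (n := n)) := by
  have h : ContDiff ℝ ((2 : ℕ)) (deriv expNegInvGlue) := contDiff_deriv_expNegInvGlue
  exact contDiff_const.mul ((show ContDiff ℝ 2 (deriv expNegInvGlue) by exact_mod_cast h).comp
    (contDiff_const.sub (contDiff_norm_sq ℝ)))

theorem deriv_expNegInvGlue_nonneg (s : ℝ) : 0 ≤ deriv expNegInvGlue s :=
  expNegInvGlue.monotone.deriv_nonneg

theorem deriv_expNegInvGlue_of_nonpos {s : ℝ} (hs : s ≤ 0) : deriv expNegInvGlue s = 0 := by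
  have hmin : IsLocalMin expNegInvGlue s := by
    refine Eventually.of_forall fun y => ?_
    rw [expNegInvGlue.zero_of_nonpos hs]
    exact expNegInvGlue.nonneg y
  exact hmin.deriv_eq_zero

theorem bumpRho_nonneg {n : ℕ} (x : En n) : 0 ≤ bumpRho x :=
  mul_nonneg zero_le_two (deriv_expNegInvGlue_nonneg _)

theorem bumpPhi_nonneg {n : ℕ} (x : En n) : 0 ≤ bumpPhi x := expNegInvGlue.nonneg _

theorem one_sub_norm_sq_nonpos {n : ℕ} {x : En n} (hx : 1 ≤ ‖x‖) : 1 - ‖x‖ ^ 2 ≤ 0 := by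
  nlinarith

theorem bumpRho_zero_off {n : ℕ} {x : En n} (hx : 1 ≤ ‖x‖) : bumpRho x = 0 := by
  rw [bumpRho, deriv_expNegInvGlue_of_nonpos (one_sub_norm_sq_nonpos hx), mul_zero]

theorem bumpPhi_zero_off {n : ℕ} {x : En n} (hx : 1 ≤ ‖x‖) : bumpPhi x = 0 :=
  expNegInvGlue.zero_of_nonpos (one_sub_norm_sq_nonpos hx)

theorem bumpPhi_pos {n : ℕ} {x : En n} (hx : ‖x‖ < 1) : 0 < bumpPhi x :=
  expNegInvGlue.pos_of_pos (by nlinarith [norm_nonneg x])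

theorem bumpPhi_anti {n : ℕ} {x y : En n} (h : ‖x‖ ≤ ‖y‖) : bumpPhi y ≤ bumpPhi x :=
  expNegInvGlue.monotone (by nlinarith [norm_nonneg x])

theorem hasFDerivAt_comp_one_sub_norm_sq {n : ℕ} {f : ℝ → ℝ} (hf : Differentiable ℝ f)
    (x : En n) : HasFDerivAt (fun x : En n => f (1 - ‖x‖ ^ 2))
      ((-(2 * deriv f (1 - ‖x‖ ^ 2))) • innerSL ℝ x) x := by
  have h1 : HasFDerivAt (fun x : En n => 1 - ‖x‖ ^ 2) (-(2 • innerSL ℝ x)) x := by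
    simpa using (hasStrictFDerivAt_norm_sq x).hasFDerivAt.const_sub 1
  have h2 := (hf (1 - ‖x‖ ^ 2)).hasDerivAt.comp_hasFDerivAt x h1
  refine h2.congr_fderiv ?_
  ext y
  simp
  ring

theorem bumpPhi_fderiv {n : ℕ} (x e : En n) : fderiv ℝ bumpPhi x e = -bumpRho x * inner ℝ x e := by
  have h : Differentiable ℝ expNegInvGlue :=
    (expNegInvGlue.contDiff (n := 1)).differentiable (by simp)
  have := (hasFDerivAt_comp_one_sub_norm_sq h x).fderiv
  change fderiv ℝ bumpPhi x = _ at this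
  rw [this]
  simp [bumpRho]

theorem exists_bumpRho_fderiv {n : ℕ} (x : En n) :
    ∃ c, ∀ e, fderiv ℝ bumpRho x e = c * inner ℝ x e := by
  have h : Differentiable ℝ (fun s => 2 * deriv expNegInvGlue s) :=
    ((contDiff_deriv_expNegInvGlue (m := 1)).differentiable (by simp)).const_mul 2
  have := (hasFDerivAt_comp_one_sub_norm_sq h x).fderiv
  change fderiv ℝ bumpRho x = _ at this
  rw [this]
  exact ⟨_, fun e => rfl⟩

theorem lipInBall_of_contDiff {n : ℕ} {F : Type*} [NormedAddCommGroup F] [NormedSpace ℝ F]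
    {f : En n → F} (hf : ContDiff ℝ 1 f) (h0 : ∀ x, 1 ≤ ‖x‖ → f x = 0) : LipInBall f := by
  refine ⟨?_, h0⟩
  have hc : HasCompactSupport f := by
    refine HasCompactSupport.intro (isCompact_closedBall 0 1) fun x hx => h0 x ?_
    have : 1 < ‖x‖ := by simpa using hx
    exact this.le
  exact hf.lipschitzWith_of_hasCompactSupport hc (by simp)

theorem bumpRho_lip {n : ℕ} : LipInBall (bumpRho (n := n)) :=
  lipInBall_of_contDiff (bumpRho_contDiff.of_le (by norm_num)) fun _ => bumpRho_zero_off

theorem bumpPhi_lip {n : ℕ} : LipInBall (bumpPhi (n := n)) :=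
  lipInBall_of_contDiff (bumpPhi_contDiff.of_le (by norm_num)) fun _ => bumpPhi_zero_off

theorem diverg_smul {n : ℕ} {η : En n → ℝ} {w : En n → En n} {x : En n}
    (hη : DifferentiableAt ℝ η x) (hw : DifferentiableAt ℝ w x) :
    diverg (fun y => η y • w y) x = η x * diverg w x + fderiv ℝ η x (w x) := by
  rw [diverg, (hη.hasFDerivAt.fun_smul hw.hasFDerivAt).fderiv, diverg]
  simp only [ContinuousLinearMap.toLinearMap_add, map_add, ContinuousLinearMap.toLinearMap_smul,
    map_smul, smul_eq_mul]
  congr 1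
  exact LinearMap.trace_smulRight _ _

theorem diverg_sub {n : ℕ} {w z : En n → En n} {x : En n}
    (hw : DifferentiableAt ℝ w x) (hz : DifferentiableAt ℝ z x) :
    diverg (fun y => w y - z y) x = diverg w x - diverg z x := by
  rw [diverg, (hw.hasFDerivAt.fun_sub hz.hasFDerivAt).fderiv, diverg, diverg]
  simp

theorem diverg_id {n : ℕ} (x : En n) : diverg (fun y : En n => y) x = n := by
  rw [diverg]
  simp [LinearMap.trace_id]

theorem LipInBall.integrable_smul {n : ℕ} {F : Type*} [NormedAddCommGroup F] [NormedSpace ℝ F]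
    {η : En n → ℝ} (hη : LipInBall η) {g : En n → F} (hg : AEStronglyMeasurable g volume)
    (C : ℝ) (hb : ∀ x, ‖x‖ ≤ 1 → ‖g x‖ ≤ C) : Integrable (fun x => η x • g x) := by
  obtain ⟨M, hM, hM'⟩ := hη.exists_bound
  refine integrable_of_bounded_of_zero_off_ball (M * C)
    (hη.1.choose_spec.continuous.aestronglyMeasurable.smul hg)
    (Eventually.of_forall fun x hx => ?_) fun x hx => by rw [hη.2 x hx.le, zero_smul]
  rw [norm_smul]
  exact mul_le_mul (hM' x) (hb x hx) (norm_nonneg _) hM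

theorem bumpRho_differentiable {n : ℕ} : Differentiable ℝ (bumpRho (n := n)) :=
  bumpRho_contDiff.differentiable (by norm_num)

theorem bumpPhi_differentiable {n : ℕ} : Differentiable ℝ (bumpPhi (n := n)) :=
  bumpPhi_contDiff.differentiable (by norm_num)

theorem bumpRho_fderiv_zero_off {n : ℕ} {x : En n} (hx : 1 ≤ ‖x‖) :
    fderiv ℝ bumpRho x = 0 := by
  refine IsLocalMin.fderiv_eq_zero (Eventually.of_forall fun y => ?_)
  rw [bumpRho_zero_off hx]
  exact bumpRho_nonneg y

theorem bumpRho_fderiv_contDiff {n : ℕ} : ContDiff ℝ 1 (fderiv ℝ (bumpRho (n := n))) :=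
  bumpRho_contDiff.fderiv_right (by norm_num)

/-- The divergence of the field `bumpRho x • x`. -/
def bumpDiv {n : ℕ} (x : En n) : ℝ := n * bumpRho x + fderiv ℝ bumpRho x x

theorem bumpDiv_lip {n : ℕ} : LipInBall (bumpDiv (n := n)) := by
  refine lipInBall_of_contDiff ?_ fun x hx => ?_
  · exact (contDiff_const.mul (bumpRho_contDiff.of_le (by norm_num))).add
      (bumpRho_fderiv_contDiff.clm_apply contDiff_id)
  · simp [bumpDiv, bumpRho_zero_off hx, bumpRho_fderiv_zero_off hx]

theorem hasFDerivAt_bump_inner {n : ℕ} {z : En n → En n} {x : En n}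
    (hz : DifferentiableAt ℝ z x) (a : En n) :
    DifferentiableAt ℝ (fun y => inner ℝ (bumpRho y • y) (z y)) x ∧
    fderiv ℝ (fun y => inner ℝ (bumpRho y • y) (z y)) x a =
      fderiv ℝ bumpRho x a * inner ℝ x (z x) +
        bumpRho x * (inner ℝ a (z x) + inner ℝ x (fderiv ℝ z x a)) := by
  have h1 := (bumpRho_differentiable x).hasFDerivAt.smul (hasFDerivAt_id x)
  have h := h1.inner ℝ hz.hasFDerivAt
  refine ⟨h.differentiableAt, ?_⟩
  refine (congrArg (fun L => L a) h.fderiv).trans ?_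
  simp [inner_add_left, inner_smul_left, mul_add]
  ring

/-- The antisymmetric pairing of two gradient fields against the radial weight. -/
theorem integral_bump_exchange {n : ℕ} {w z : En n → En n} {K L : NNReal}
    (hw : LipschitzWith K w) (hz : LipschitzWith L z)
    (sw : ∀ᵐ x, ‖x‖ < 1 → ∀ a b, inner ℝ (fderiv ℝ w x a) b = inner ℝ a (fderiv ℝ w x b))
    (sz : ∀ᵐ x, ‖x‖ < 1 → ∀ a b, inner ℝ (fderiv ℝ z x a) b = inner ℝ a (fderiv ℝ z x b)) :
    ∫ x, bumpRho x * (diverg w x * inner ℝ x (z x) - diverg z x * inner ℝ x (w x)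
      + inner ℝ (w x) (fderiv ℝ z x x) - inner ℝ (z x) (fderiv ℝ w x x)) = 0 := by
  have hρ : LipInBall (fun x : En n => bumpRho x • x) := bumpRho_lip.smul LipschitzWith.id
  have hY := ((hρ.inner_lip hz).smul hw).sub ((hρ.inner_lip hw).smul hz)
  rw [← hY.integral_diverg_eq_zero]
  refine integral_congr_ae ?_
  filter_upwards [sw, sz, hw.ae_differentiableAt, hz.ae_differentiableAt] with x sw sz dw dz
  have d1 := hasFDerivAt_bump_inner dz (w x)
  have d2 := hasFDerivAt_bump_inner dw (z x)
  rw [diverg_sub (d1.1.fun_smul dw) (d2.1.fun_smul dz), diverg_smul d1.1 dw, diverg_smul d2.1 dz,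
    d1.2, d2.2]
  obtain ⟨c, hc⟩ := exists_bumpRho_fderiv x
  rw [hc, hc, inner_smul_left, inner_smul_left, real_inner_comm (w x) (z x)]
  rcases lt_or_ge ‖x‖ 1 with hx | hx
  · rw [← sz hx (w x) x, ← sw hx (z x) x, real_inner_comm _ (fderiv ℝ z x (w x)),
      real_inner_comm _ (fderiv ℝ w x (z x))]
    simp only [conj_trivial]
    ring
  · rw [bumpRho_zero_off hx]
    simp
    ring

theorem integral_bumpPhi_diverg {n : ℕ} {w : En n → En n} {K : NNReal}
    (hw : LipschitzWith K w) :
    ∫ x, (bumpPhi x * diverg w x - bumpRho x * inner ℝ x (w x)) = 0 := by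
  rw [← (bumpPhi_lip.smul hw).integral_diverg_eq_zero]
  refine integral_congr_ae ?_
  filter_upwards [hw.ae_differentiableAt] with x dw
  rw [diverg_smul (bumpPhi_differentiable x) dw, bumpPhi_fderiv]
  ring

theorem integral_bump_radial {n : ℕ} {w : En n → En n} {K : NNReal}
    (hw : LipschitzWith K w) :
    ∫ x, (bumpDiv x * ‖w x‖ ^ 2 + 2 * (bumpRho x * inner ℝ (w x) (fderiv ℝ w x x))) = 0 := by
  have hρ : LipInBall (fun x : En n => bumpRho x • w x) := bumpRho_lip.smul hw
  rw [← ((hρ.inner_lip hw).smul LipschitzWith.id).integral_diverg_eq_zero]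
  refine integral_congr_ae ?_
  filter_upwards [hw.ae_differentiableAt] with x dw
  have h := ((bumpRho_differentiable x).hasFDerivAt.fun_smul dw.hasFDerivAt).inner ℝ dw.hasFDerivAt
  have e : fderiv ℝ (fun y => inner ℝ (bumpRho y • w y) (w y)) x x = _ :=
    congrArg (fun L => L x) h.fderiv
  change _ = diverg (fun y => inner ℝ (bumpRho y • w y) (w y) • (fun y => y) y) x
  rw [diverg_smul h.differentiableAt differentiableAt_fun_id, diverg_id]
  change _ = _ + fderiv ℝ (fun y => inner ℝ (bumpRho y • w y) (w y)) x x
  rw [e]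
  simp [inner_add_left, inner_smul_left, bumpDiv, real_inner_comm (w x) (fderiv ℝ w x x)]
  ring

theorem integral_bump_fderiv {n : ℕ} {w : En n → En n} {K : NNReal}
    (hw : LipschitzWith K w) (a e : En n) :
    ∫ x, (bumpRho x * inner ℝ (fderiv ℝ w x a) e + fderiv ℝ bumpRho x a * inner ℝ (w x) e) = 0 := by
  have hρ : LipInBall (fun x : En n => bumpRho x • w x) := bumpRho_lip.smul hw
  rw [← (hρ.inner_lip (LipschitzWith.const e)).integral_fderiv_eq_zero a]
  refine integral_congr_ae ?_
  filter_upwards [hw.ae_differentiableAt] with x dw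
  have h := ((bumpRho_differentiable x).hasFDerivAt.fun_smul dw.hasFDerivAt).inner ℝ
    (hasFDerivAt_const e x)
  refine Eq.trans ?_ (congrArg (fun L => L a) h.fderiv).symm
  simp [inner_add_left, inner_smul_left]

/-- A Lipschitz field which on the unit ball is curl free, has divergence one off its zero set,
and has vanishing derivative a.e. on its zero set. -/
def FreeBdryField {n : ℕ} (K : NNReal) (w : En n → En n) : Prop :=
  LipschitzWith K w ∧ w 0 = 0 ∧ ∀ᵐ x, ‖x‖ < 1 →
    (∀ a b, inner ℝ (fderiv ℝ w x a) b = inner ℝ a (fderiv ℝ w x b)) ∧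
    (w x ≠ 0 → diverg w x = 1) ∧ (w x = 0 → fderiv ℝ w x = 0)

/-- The parabolic-type rescaling flow `e^t w(e^{-t} x)`. -/
def flow {n : ℕ} (w : En n → En n) (t : ℝ) (x : En n) : En n :=
  Real.exp t • w (Real.exp (-t) • x)

theorem ae_comp_smul {n : ℕ} {P : En n → Prop} (hP : ∀ᵐ x, P x) (a : En n) {c : ℝ} (hc : c ≠ 0) :
    ∀ᵐ y, P (a + c • y) := by
  have h1 : ∀ᵐ y, P (a + y) :=
    (measurePreserving_add_left volume a).quasiMeasurePreserving.ae hP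
  rw [ae_iff] at h1 ⊢
  have := Measure.addHaar_preimage_smul (volume : Measure (En n)) hc {y | ¬ P (a + y)}
  rw [h1, mul_zero] at this
  exact this

theorem flow_flow {n : ℕ} (w : En n → En n) (t s : ℝ) : flow (flow w t) s = flow w (t + s) := by
  funext x
  simp only [flow, smul_smul, ← Real.exp_add]
  rw [neg_add, add_comm s t]

theorem flow_lip {n : ℕ} {w : En n → En n} {K : NNReal} (hw : LipschitzWith K w) (t : ℝ) :
    LipschitzWith K (flow w t) := by
  refine LipschitzWith.of_dist_le_mul fun x y => ?_
  rw [flow, flow, dist_smul₀, Real.norm_of_nonneg (Real.exp_nonneg _)]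
  calc Real.exp t * dist (w (Real.exp (-t) • x)) (w (Real.exp (-t) • y))
      ≤ Real.exp t * (K * dist (Real.exp (-t) • x) (Real.exp (-t) • y)) := by
        gcongr; exact hw.dist_le_mul _ _
    _ = K * dist x y := by
        rw [dist_smul₀, Real.norm_of_nonneg (Real.exp_nonneg _), Real.exp_neg]
        field_simp

theorem flow_zero_right {n : ℕ} {w : En n → En n} (h0 : w 0 = 0) (t : ℝ) : flow w t 0 = 0 := by
  simp [flow, h0]

theorem flow_fderiv {n : ℕ} (w : En n → En n) (t : ℝ) (x : En n) :
    fderiv ℝ (flow w t) x = fderiv ℝ w (Real.exp (-t) • x) := by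
  change fderiv ℝ (fun x => Real.exp t • w (Real.exp (-t) • x)) x = _
  have : (fun x => Real.exp t • w (Real.exp (-t) • x))
      = Real.exp t • fun x => w (Real.exp (-t) • x) := rfl
  rw [this, fderiv_const_smul_field, Pi.smul_apply, fderiv_comp_smul, smul_smul, ← Real.exp_add]
  simp

theorem FreeBdryField.flow {n : ℕ} {K : NNReal} {w : En n → En n} (hw : FreeBdryField K w)
    {t : ℝ} (ht : 0 ≤ t) : FreeBdryField K (flow w t) := by
  refine ⟨flow_lip hw.1 t, flow_zero_right hw.2.1 t, ?_⟩
  have := ae_comp_smul hw.2.2 0 (Real.exp_ne_zero (-t))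
  filter_upwards [this] with x hx hx1
  rw [zero_add] at hx
  have h1 : ‖Real.exp (-t) • x‖ < 1 := by
    rw [norm_smul, Real.norm_of_nonneg (Real.exp_nonneg _)]
    have : Real.exp (-t) ≤ 1 := Real.exp_le_one_iff.2 (by linarith)
    nlinarith [norm_nonneg x]
  have h2 : _root_.flow w t x = 0 ↔ w (Real.exp (-t) • x) = 0 := by
    simp [_root_.flow, Real.exp_ne_zero]
  rw [diverg, flow_fderiv, Ne, h2]
  exact hx h1

theorem norm_le_of_lip {n : ℕ} {K : NNReal} {w : En n → En n} (hw : LipschitzWith K w)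
    (h0 : w 0 = 0) (x : En n) : ‖w x‖ ≤ K * ‖x‖ := by
  simpa [h0] using hw.norm_sub_le x 0

theorem flow_time_lip {n : ℕ} {K : NNReal} {w : En n → En n} (hw : LipschitzWith K w)
    (h0 : w 0 = 0) {s t : ℝ} (h : |s - t| ≤ 1) (x : En n) :
    ‖flow w s x - flow w t x‖ ≤ 4 * K * ‖x‖ * |s - t| := by
  obtain ⟨τ, rfl⟩ : ∃ τ, s = t + τ := ⟨s - t, by ring⟩
  rw [← flow_flow]
  have hv := flow_lip hw t
  have hv0 := flow_zero_right h0 t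
  generalize flow w t = v at hv hv0
  rw [add_sub_cancel_left] at h ⊢
  have e : flow v τ x - v x = Real.exp τ • (v (Real.exp (-τ) • x) - v x)
      + (Real.exp τ - 1) • v x := by
    rw [flow, smul_sub, sub_smul, one_smul]; abel
  have h1 : ‖v (Real.exp (-τ) • x) - v x‖ ≤ K * (|Real.exp (-τ) - 1| * ‖x‖) := by
    refine (hv.norm_sub_le _ _).trans_eq ?_
    rw [← Real.norm_eq_abs, ← norm_smul, sub_smul, one_smul]
  have h2 : Real.exp τ * |Real.exp (-τ) - 1| = |Real.exp τ - 1| := by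
    rw [← abs_of_pos (Real.exp_pos τ), ← abs_mul, abs_of_pos (Real.exp_pos τ), mul_sub,
      ← Real.exp_add, mul_one, add_neg_cancel, Real.exp_zero, abs_sub_comm]
  have h3 := Real.abs_exp_sub_one_le h
  have h4 := norm_le_of_lip hv hv0 x
  rw [e]
  calc _ ≤ Real.exp τ * (K * (|Real.exp (-τ) - 1| * ‖x‖)) + |Real.exp τ - 1| * (K * ‖x‖) := by
        refine (norm_add_le _ _).trans ?_
        rw [norm_smul, norm_smul, Real.norm_of_nonneg (Real.exp_nonneg _), Real.norm_eq_abs]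
        gcongr
    _ = 2 * K * ‖x‖ * |Real.exp τ - 1| := by rw [← h2]; ring
    _ ≤ 2 * K * ‖x‖ * (2 * |τ|) := by gcongr
    _ = _ := by ring

/-- The time derivative of the flow at a field `w`. -/
def radialDefect {n : ℕ} (w : En n → En n) (x : En n) : En n := w x - fderiv ℝ w x x

theorem measurable_radialDefect {n : ℕ} {K : NNReal} {w : En n → En n} (hw : LipschitzWith K w) :
    Measurable (radialDefect w) :=
  hw.continuous.measurable.sub
    (isBoundedBilinearMap_apply.continuous.measurable.comp
      ((measurable_fderiv ℝ w).prodMk measurable_id))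

theorem hasDerivAt_flow {n : ℕ} {K : NNReal} {w : En n → En n} (hw : LipschitzWith K w) (t : ℝ) :
    ∀ᵐ x, HasDerivAt (fun s => flow w s x) (radialDefect (flow w t) x) t := by
  have := ae_comp_smul hw.ae_differentiableAt 0 (Real.exp_ne_zero (-t))
  filter_upwards [this] with x hx
  rw [zero_add] at hx
  have h1 : HasDerivAt (fun s : ℝ => Real.exp (-s) • x) (-Real.exp (-t) • x) t := by
    simpa using ((Real.hasDerivAt_exp (-t)).comp t (hasDerivAt_neg t)).smul_const x
  have h2 := hx.hasFDerivAt.comp_hasDerivAt t h1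
  have h3 := (Real.hasDerivAt_exp t).smul h2
  refine h3.congr_deriv ?_
  rw [radialDefect, flow_fderiv, map_smul, smul_smul, mul_neg, ← Real.exp_add, add_neg_cancel,
    Real.exp_zero, flow]
  simp
  abel

theorem hasDerivAt_integral_bump {n : ℕ} {κ : En n → ℝ} (hκ : LipInBall κ) {G : ℝ → En n → ℝ}
    {G' : En n → ℝ} {t : ℝ} (hm : ∀ s, Continuous (G s)) (hm' : Measurable G') (C L : ℝ)
    (hL : 0 ≤ L)
    (hb : ∀ x, ‖x‖ ≤ 1 → ‖G t x‖ ≤ C)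
    (hlip : ∀ x, ‖x‖ ≤ 1 → ∀ s s', |s - t| < 1 / 2 → |s' - t| < 1 / 2 →
      ‖G s x - G s' x‖ ≤ L * |s - s'|)
    (hd : ∀ᵐ x, HasDerivAt (fun s => G s x) (G' x) t) :
    HasDerivAt (fun s => ∫ x, κ x * G s x) (∫ x, κ x * G' x) t := by
  have hκc := hκ.1.choose_spec.continuous
  refine (hasDerivAt_integral_of_dominated_loc_of_lip (F := fun s x => κ x * G s x)
    (F' := fun x => κ x * G' x) (s := ball t (1 / 2))
    (bound := fun x => |κ x| * L) (ball_mem_nhds t (by norm_num))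
    (Eventually.of_forall fun s => (hκc.mul (hm s)).aestronglyMeasurable)
    (hκ.integrable_smul (hm t).aestronglyMeasurable C hb)
    (hκc.measurable.mul hm').aestronglyMeasurable
    (Eventually.of_forall fun x => ?_) ?_ ?_).2
  · refine LipschitzOnWith.of_dist_le_mul fun s hs s' hs' => ?_
    rw [Real.coe_nnabs, abs_of_nonneg (by positivity : 0 ≤ |κ x| * L), dist_eq_norm, ← mul_sub,
      norm_mul, Real.norm_eq_abs, mul_assoc]
    rcases le_or_gt ‖x‖ 1 with hx | hx
    · have := hlip x hx s s' hs hs'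
      rw [Real.dist_eq]
      gcongr
    · rw [hκ.2 x hx.le]; simp
  · have := (hκ.integrable_smul (g := fun _ => L) aestronglyMeasurable_const |L|
      fun x _ => le_rfl).norm
    refine this.congr (Eventually.of_forall fun x => ?_)
    simp [abs_of_nonneg hL]
  · filter_upwards [hd] with x hx
    exact hx.const_mul _

theorem hasDerivAt_integral_normSq {n : ℕ} {κ : En n → ℝ} (hκ : LipInBall κ)
    {g : ℝ → En n → En n} {g' : En n → En n} {t : ℝ} (hm : ∀ s, Continuous (g s))
    (hm' : Measurable g') (C L : ℝ) (hC : 0 ≤ C) (hL : 0 ≤ L)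
    (hb : ∀ s x, ‖x‖ ≤ 1 → ‖g s x‖ ≤ C)
    (hlip : ∀ x, ‖x‖ ≤ 1 → ∀ s s', |s - t| < 1 / 2 → |s' - t| < 1 / 2 →
      ‖g s x - g s' x‖ ≤ L * |s - s'|)
    (hd : ∀ᵐ x, HasDerivAt (fun s => g s x) (g' x) t) :
    HasDerivAt (fun s => ∫ x, κ x * ‖g s x‖ ^ 2) (∫ x, κ x * (2 * inner ℝ (g t x) (g' x))) t := by
  refine hasDerivAt_integral_bump hκ (fun s => (hm s).norm.pow 2)
    (((hm t).measurable.inner hm').const_mul 2) (C ^ 2) (2 * C * L) (by positivity)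
    (fun x hx => ?_) (fun x hx s s' hs hs' => ?_) ?_
  · rw [norm_pow, norm_norm]
    exact pow_le_pow_left₀ (norm_nonneg _) (hb t x hx) 2
  · have h1 := hlip x hx s s' hs hs'
    have h2 := abs_norm_sub_norm_le (g s x) (g s' x)
    have h3 := hb s x hx
    have h4 := hb s' x hx
    rw [Real.norm_eq_abs, sq_sub_sq, abs_mul]
    have h5 : |‖g s x‖ + ‖g s' x‖| ≤ 2 * C := by
      rw [abs_of_nonneg (by positivity)]; linarith
    calc _ ≤ 2 * C * (L * |s - s'|) := by
          gcongr
          exact h2.trans h1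
      _ = _ := by ring
  · filter_upwards [hd] with x hx
    exact hx.norm_sq

theorem integrable_lambda_sub {n : ℕ} {f g : En n → ℝ} (hf : Integrable f) (hg : Integrable g) :
    Integrable (fun x => f x - g x) := hf.sub hg

/-- The weight of the quadratic term of the energy. -/
def bumpKappa {n : ℕ} (x : En n) : ℝ := bumpRho x + bumpDiv x / 2

theorem bumpKappa_lip {n : ℕ} : LipInBall (bumpKappa (n := n)) := by
  refine lipInBall_of_contDiff ?_ fun x hx => ?_
  · exact (bumpRho_contDiff.of_le (by norm_num)).add
      (((contDiff_const.mul (bumpRho_contDiff.of_le (by norm_num))).add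
      (bumpRho_fderiv_contDiff.clm_apply contDiff_id)).div_const 2)
  · simp [bumpKappa, bumpDiv, bumpRho_zero_off hx, bumpRho_fderiv_zero_off hx]

/-- The monotone quantity of the rescaling flow. -/
def energy {n : ℕ} (w : En n → En n) : ℝ :=
  (∫ x, bumpRho x * inner ℝ x (w x)) - ∫ x, bumpKappa x * ‖w x‖ ^ 2

theorem LipInBall.integrable_mul {n : ℕ} {η : En n → ℝ} (hη : LipInBall η) {g : En n → ℝ}
    (hg : Measurable g) (C : ℝ) (hb : ∀ x, ‖x‖ ≤ 1 → ‖g x‖ ≤ C) :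
    Integrable (fun x => η x * g x) :=
  hη.integrable_smul hg.aestronglyMeasurable C hb

theorem norm_le_one_of_lip {n : ℕ} {K : NNReal} {w : En n → En n} (hw : LipschitzWith K w)
    (h0 : w 0 = 0) {x : En n} (hx : ‖x‖ ≤ 1) : ‖w x‖ ≤ K :=
  (norm_le_of_lip hw h0 x).trans (mul_le_of_le_one_right K.2 hx)

theorem norm_fderiv_apply_self_le {n : ℕ} {K : NNReal} {w : En n → En n} (hw : LipschitzWith K w)
    {x : En n} (hx : ‖x‖ ≤ 1) : ‖fderiv ℝ w x x‖ ≤ K :=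
  ((fderiv ℝ w x).le_opNorm x).trans
    ((mul_le_of_le_one_right (norm_nonneg _) hx).trans (norm_fderiv_le_of_lipschitz ℝ hw))

theorem norm_radialDefect_le {n : ℕ} {K : NNReal} {w : En n → En n} (hw : LipschitzWith K w)
    (h0 : w 0 = 0) {x : En n} (hx : ‖x‖ ≤ 1) : ‖radialDefect w x‖ ≤ 2 * K := by
  have := norm_sub_le (w x) (fderiv ℝ w x x)
  have := norm_le_one_of_lip hw h0 hx
  have := norm_fderiv_apply_self_le hw hx
  rw [radialDefect]
  linarith

theorem norm_inner_self_le {n : ℕ} {x a : En n} {C : ℝ} (hx : ‖x‖ ≤ 1) (ha : ‖a‖ ≤ C) :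
    ‖(inner ℝ x a : ℝ)‖ ≤ C :=
  (norm_inner_le_norm x a).trans ((mul_le_of_le_one_left (norm_nonneg a) hx).trans ha)

theorem norm_inner_le_of_le {n : ℕ} {a b : En n} {C D : ℝ} (ha : ‖a‖ ≤ C) (hb : ‖b‖ ≤ D) :
    ‖(inner ℝ a b : ℝ)‖ ≤ C * D :=
  (norm_inner_le_norm a b).trans
    (mul_le_mul ha hb (norm_nonneg _) ((norm_nonneg _).trans ha))

theorem measurable_fderiv_apply_self {n : ℕ} (w : En n → En n) :
    Measurable (fun x => fderiv ℝ w x x) :=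
  isBoundedBilinearMap_apply.continuous.measurable.comp
    ((measurable_fderiv ℝ w).prodMk measurable_id)

theorem integrable_rho_inner_self {n : ℕ} {K : NNReal} {w : En n → En n}
    (hw : LipschitzWith K w) (h0 : w 0 = 0) :
    Integrable (fun x => bumpRho x * inner ℝ x (w x)) :=
  bumpRho_lip.integrable_mul (measurable_id.inner hw.continuous.measurable) K
    fun _ hx => norm_inner_self_le hx (norm_le_one_of_lip hw h0 hx)

theorem energy_eq {n : ℕ} {K : NNReal} {w : En n → En n} (hw : LipschitzWith K w) (h0 : w 0 = 0) :
    energy w = ∫ x, bumpRho x * (inner ℝ x (w x) - inner ℝ (w x) (radialDefect w x)) := by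
  have hwm := hw.continuous.measurable
  have hn : ∀ x : En n, ‖x‖ ≤ 1 → ‖‖w x‖ ^ 2‖ ≤ (K : ℝ) ^ 2 := fun x hx => by
    rw [norm_pow, norm_norm]
    exact pow_le_pow_left₀ (norm_nonneg _) (norm_le_one_of_lip hw h0 hx) 2
  have i1 := integrable_rho_inner_self hw h0
  have i2 : Integrable (fun x => bumpKappa x * ‖w x‖ ^ 2) :=
    bumpKappa_lip.integrable_mul (hwm.norm.pow_const 2) _ hn
  have i3 : Integrable (fun x => bumpDiv x * ‖w x‖ ^ 2) :=
    bumpDiv_lip.integrable_mul (hwm.norm.pow_const 2) _ hn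
  have i4 : Integrable (fun x => bumpRho x * inner ℝ (w x) (fderiv ℝ w x x)) :=
    bumpRho_lip.integrable_mul (hwm.inner (measurable_fderiv_apply_self w)) _
      fun x hx => norm_inner_le_of_le (norm_le_one_of_lip hw h0 hx)
        (norm_fderiv_apply_self_le hw hx)
  have hr := integral_bump_radial hw
  have e : energy w = energy w +
      (∫ x, (bumpDiv x * ‖w x‖ ^ 2 + 2 * (bumpRho x * inner ℝ (w x) (fderiv ℝ w x x)))) / 2 := by
    rw [hr]; ring
  rw [e, energy, ← integral_sub i1 i2, ← integral_div, ← integral_add (integrable_lambda_sub i1 i2)]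
  · refine integral_congr_ae (Eventually.of_forall fun x => ?_)
    simp only [bumpKappa, radialDefect, inner_sub_right, real_inner_self_eq_norm_sq]
    ring
  · exact (i3.add (i4.const_mul 2)).div_const 2

/-- The contribution of the zero sets to the antisymmetric pairing of two fields. -/
def swapDefect {n : ℕ} (w z : En n → En n) (x : En n) : ℝ :=
  {y | z y = 0}.indicator (fun y => inner ℝ y (w y)) x -
    {y | w y = 0}.indicator (fun y => inner ℝ y (z y)) x

theorem measurable_swapDefect {n : ℕ} {w z : En n → En n} (hw : Continuous w) (hz : Continuous z) :
    Measurable (swapDefect w z) :=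
  ((measurable_id.inner hw.measurable).indicator (isClosed_eq hz continuous_const).measurableSet).sub
    ((measurable_id.inner hz.measurable).indicator (isClosed_eq hw continuous_const).measurableSet)

theorem diverg_eq_of_free {n : ℕ} {w : En n → En n} {x : En n} (h1 : w x ≠ 0 → diverg w x = 1)
    (h2 : w x = 0 → fderiv ℝ w x = 0) : diverg w x = {y | w y ≠ 0}.indicator 1 x := by
  by_cases h : w x = 0
  · rw [diverg, h2 h]; simp [h]
  · rw [h1 h]; simp [h]

theorem energy_sub {n : ℕ} {K L : NNReal} {w z : En n → En n} (hw : FreeBdryField K w)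
    (hz : FreeBdryField L z) :
    energy w - energy z = (∫ x, bumpRho x * swapDefect w z x) -
      ∫ x, bumpRho x * inner ℝ (w x - z x) (radialDefect w x + radialDefect z x) := by
  obtain ⟨hw, hw0, hwf⟩ := hw
  obtain ⟨hz, hz0, hzf⟩ := hz
  have mw := hw.continuous.measurable
  have mz := hz.continuous.measurable
  have bw := fun (x : En n) (hx : ‖x‖ ≤ 1) => norm_le_one_of_lip hw hw0 hx
  have bz := fun (x : En n) (hx : ‖x‖ ≤ 1) => norm_le_one_of_lip hz hz0 hx
  have hex := integral_bump_exchange hw hz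
    (hwf.mono fun x h hx => (h hx).1) (hzf.mono fun x h hx => (h hx).1)
  have hex' : ∫ x, bumpRho x * ({y | w y ≠ 0}.indicator 1 x * inner ℝ x (z x)
      - {y | z y ≠ 0}.indicator 1 x * inner ℝ x (w x)
      + inner ℝ (w x) (fderiv ℝ z x x) - inner ℝ (z x) (fderiv ℝ w x x)) = 0 := by
    rw [← hex]
    refine integral_congr_ae ?_
    filter_upwards [hwf, hzf] with x h1 h2
    rcases lt_or_ge ‖x‖ 1 with hx | hx
    · rw [diverg_eq_of_free (h1 hx).2.1 (h1 hx).2.2, diverg_eq_of_free (h2 hx).2.1 (h2 hx).2.2]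
    · simp [bumpRho_zero_off hx]
  have i1 : Integrable fun x => bumpRho x *
      (inner ℝ x (w x) - inner ℝ (w x) (radialDefect w x)) := by
    refine bumpRho_lip.integrable_mul ((measurable_id.inner mw).sub
      (mw.inner (measurable_radialDefect hw))) (K + K * (2 * K)) fun x hx => ?_
    exact (norm_sub_le _ _).trans (add_le_add (norm_inner_self_le hx (bw x hx))
      (norm_inner_le_of_le (bw x hx) (norm_radialDefect_le hw hw0 hx)))
  have i2 : Integrable fun x => bumpRho x *
      (inner ℝ x (z x) - inner ℝ (z x) (radialDefect z x)) := by
    refine bumpRho_lip.integrable_mul ((measurable_id.inner mz).sub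
      (mz.inner (measurable_radialDefect hz))) (L + L * (2 * L)) fun x hx => ?_
    exact (norm_sub_le _ _).trans (add_le_add (norm_inner_self_le hx (bz x hx))
      (norm_inner_le_of_le (bz x hx) (norm_radialDefect_le hz hz0 hx)))
  have i3 : Integrable fun x => bumpRho x * swapDefect w z x := by
    refine bumpRho_lip.integrable_mul (measurable_swapDefect hw.continuous hz.continuous) (K + L)
      fun x hx => ?_
    exact (norm_sub_le _ _).trans (add_le_add
      ((norm_indicator_le_norm_self _ _).trans (norm_inner_self_le hx (bw x hx)))
      ((norm_indicator_le_norm_self _ _).trans (norm_inner_self_le hx (bz x hx))))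
  have i4 : Integrable fun x => bumpRho x *
      inner ℝ (w x - z x) (radialDefect w x + radialDefect z x) := by
    refine bumpRho_lip.integrable_mul ((mw.sub mz).inner
      ((measurable_radialDefect hw).add (measurable_radialDefect hz)))
      ((K + L) * (2 * K + 2 * L)) fun x hx => ?_
    exact norm_inner_le_of_le ((norm_sub_le _ _).trans (add_le_add (bw x hx) (bz x hx)))
      ((norm_add_le _ _).trans (add_le_add (norm_radialDefect_le hw hw0 hx)
        (norm_radialDefect_le hz hz0 hx)))
  have key : ∀ x, bumpRho x * ({y | w y ≠ 0}.indicator 1 x * inner ℝ x (z x)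
      - {y | z y ≠ 0}.indicator 1 x * inner ℝ x (w x)
      + inner ℝ (w x) (fderiv ℝ z x x) - inner ℝ (z x) (fderiv ℝ w x x)) =
      (bumpRho x * swapDefect w z x -
        bumpRho x * inner ℝ (w x - z x) (radialDefect w x + radialDefect z x)) -
      (bumpRho x * (inner ℝ x (w x) - inner ℝ (w x) (radialDefect w x)) -
        bumpRho x * (inner ℝ x (z x) - inner ℝ (z x) (radialDefect z x))) := by
    intro x
    have e1 : (inner ℝ (z x) (w x) : ℝ) = inner ℝ (w x) (z x) := real_inner_comm _ _
    by_cases h1 : w x = 0 <;> by_cases h2 : z x = 0 <;>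
      simp [swapDefect, radialDefect, inner_sub_left, inner_sub_right, inner_add_right, h1, h2,
        e1] <;> ring
  simp only [key] at hex'
  rw [integral_sub (integrable_lambda_sub i3 i4) (integrable_lambda_sub i1 i2), integral_sub i3 i4, integral_sub i1 i2,
    ← energy_eq hw hw0, ← energy_eq hz hz0] at hex'
  linarith

theorem norm_flow_le {n : ℕ} {K : NNReal} {w : En n → En n} (hw : LipschitzWith K w)
    (h0 : w 0 = 0) (s : ℝ) {x : En n} (hx : ‖x‖ ≤ 1) : ‖flow w s x‖ ≤ K :=
  norm_le_one_of_lip (flow_lip hw s) (flow_zero_right h0 s) hx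

theorem flow_time_lip_unit {n : ℕ} {K : NNReal} {w : En n → En n} (hw : LipschitzWith K w)
    (h0 : w 0 = 0) {s t : ℝ} (h : |s - t| ≤ 1) {x : En n} (hx : ‖x‖ ≤ 1) :
    ‖flow w s x - flow w t x‖ ≤ 4 * K * |s - t| := by
  refine (flow_time_lip hw h0 h x).trans ?_
  exact mul_le_mul_of_nonneg_right (mul_le_of_le_one_right (by positivity) hx) (abs_nonneg _)

theorem abs_sub_le_one_of_lt_half {s s' t : ℝ} (h : |s - t| < 1 / 2) (h' : |s' - t| < 1 / 2) :
    |s - s'| ≤ 1 := by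
  rw [abs_lt] at h h'
  rw [abs_le]
  constructor <;> linarith

theorem hasDerivAt_weighted_normSq_flow {n : ℕ} {K : NNReal} {w : En n → En n}
    (hw : LipschitzWith K w) (h0 : w 0 = 0) {κ : En n → ℝ} (hκ : LipInBall κ) (t : ℝ) :
    HasDerivAt (fun s => ∫ x, κ x * ‖flow w s x‖ ^ 2)
      (∫ x, κ x * (2 * inner ℝ (flow w t x) (radialDefect (flow w t) x))) t :=
  hasDerivAt_integral_normSq hκ (fun s => (flow_lip hw s).continuous)
    (measurable_radialDefect (flow_lip hw t)) K (4 * K) K.2 (by positivity)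
    (fun s _ hx => norm_flow_le hw h0 s hx)
    (fun _ hx _ _ hs hs' => flow_time_lip_unit hw h0 (abs_sub_le_one_of_lt_half hs hs') hx)
    (hasDerivAt_flow hw t)

theorem exists_hasDerivAt_energy {n : ℕ} {K : NNReal} {w : En n → En n}
    (hw : LipschitzWith K w) (h0 : w 0 = 0) (t : ℝ) :
    ∃ m, HasDerivAt (fun s => energy (flow w s)) m t := by
  have h1 : HasDerivAt (fun s => ∫ x, bumpRho x * inner ℝ x (flow w s x))
      (∫ x, bumpRho x * inner ℝ x (radialDefect (flow w t) x)) t := by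
    refine hasDerivAt_integral_bump bumpRho_lip
      (fun s => continuous_id.inner (flow_lip hw s).continuous)
      (measurable_id.inner (measurable_radialDefect (flow_lip hw t))) K (4 * K) (by positivity)
      (fun x hx => norm_inner_self_le hx (norm_flow_le hw h0 t hx))
      (fun x hx s s' hs hs' => ?_) ?_
    · rw [← inner_sub_right]
      exact norm_inner_self_le hx
        (flow_time_lip_unit hw h0 (abs_sub_le_one_of_lt_half hs hs') hx)
    · filter_upwards [hasDerivAt_flow hw t] with x hx
      simpa using (hasDerivAt_const t x).inner ℝ hx
  exact ⟨_, h1.sub (hasDerivAt_weighted_normSq_flow hw h0 bumpKappa_lip t)⟩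

theorem hasDerivAt_flow_symm {n : ℕ} {K : NNReal} {w : En n → En n} (hw : LipschitzWith K w)
    (t σ : ℝ) : ∀ᵐ x, HasDerivAt (fun σ => flow w (t + σ) x - flow w (t - σ) x)
      (radialDefect (flow w (t + σ)) x + radialDefect (flow w (t - σ)) x) σ := by
  filter_upwards [hasDerivAt_flow hw (t + σ), hasDerivAt_flow hw (t - σ)] with x h1 h2
  have h1' := h1.scomp σ ((hasDerivAt_id σ).const_add t)
  have h2' := h2.scomp σ ((hasDerivAt_id σ).const_sub t)
  refine (h1'.sub h2').congr_deriv ?_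
  simp

theorem hasDerivAt_symm_normSq {n : ℕ} {K : NNReal} {w : En n → En n} (hw : LipschitzWith K w)
    (h0 : w 0 = 0) (t σ : ℝ) :
    HasDerivAt (fun σ => ∫ x, bumpRho x * ‖flow w (t + σ) x - flow w (t - σ) x‖ ^ 2)
      (∫ x, bumpRho x * (2 * inner ℝ (flow w (t + σ) x - flow w (t - σ) x)
        (radialDefect (flow w (t + σ)) x + radialDefect (flow w (t - σ)) x))) σ := by
  refine hasDerivAt_integral_normSq (g := fun σ x => flow w (t + σ) x - flow w (t - σ) x)
    bumpRho_lip
    (fun s => (flow_lip hw _).continuous.sub (flow_lip hw _).continuous)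
    ((measurable_radialDefect (flow_lip hw _)).add (measurable_radialDefect (flow_lip hw _)))
    (K + K) (4 * K + 4 * K) (by positivity) (by positivity)
    (fun s x hx => (norm_sub_le _ _).trans
      (add_le_add (norm_flow_le hw h0 _ hx) (norm_flow_le hw h0 _ hx)))
    (fun x hx s s' hs hs' => ?_) (hasDerivAt_flow_symm hw t σ)
  have hss := abs_sub_le_one_of_lt_half hs hs'
  have e1 : t + s - (t + s') = s - s' := by ring
  have e2 : t - s - (t - s') = -(s - s') := by ring
  have h1 := flow_time_lip_unit hw h0 (s := t + s) (t := t + s') (by rwa [e1]) hx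
  have h2 := flow_time_lip_unit hw h0 (s := t - s) (t := t - s') (by rwa [e2, abs_neg]) hx
  rw [e1] at h1
  rw [e2, abs_neg] at h2
  have e : flow w (t + s) x - flow w (t - s) x - (flow w (t + s') x - flow w (t - s') x) =
      (flow w (t + s) x - flow w (t + s') x) - (flow w (t - s) x - flow w (t - s') x) := by abel
  rw [e, add_mul]
  exact (norm_sub_le _ _).trans (add_le_add h1 h2)

theorem abs_swapDefect_le {n : ℕ} (w z : En n → En n) {x : En n} (hx : ‖x‖ ≤ 1) :
    |swapDefect w z x| ≤ 2 * ‖w x - z x‖ := by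
  have h : ∀ a : En n, |(inner ℝ x a : ℝ)| ≤ ‖a‖ := fun a => norm_inner_self_le hx le_rfl
  have h1 := h (w x)
  have h2 := h (z x)
  have := norm_nonneg (w x)
  have := norm_nonneg (z x)
  by_cases hw : w x = 0 <;> by_cases hz : z x = 0 <;>
    simp [swapDefect, hw, hz] <;> linarith

theorem tendsto_swapDefect_div {n : ℕ} {K : NNReal} {w : En n → En n} (hw : FreeBdryField K w)
    {t : ℝ} (ht : 0 ≤ t) :
    Tendsto (fun σ => ∫ x, σ⁻¹ * (bumpRho x * swapDefect (flow w (t + σ)) (flow w (t - σ)) x))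
      (𝓝[>] 0) (𝓝 0) := by
  have hlip := hw.1
  have h0 := hw.2.1
  suffices h : Tendsto (fun σ => ∫ x, σ⁻¹ * (bumpRho x *
      swapDefect (flow w (t + σ)) (flow w (t - σ)) x)) (𝓝[>] 0) (𝓝 (∫ _ : En n, (0 : ℝ))) by
    simpa using h
  refine tendsto_integral_filter_of_dominated_convergence (fun x => bumpRho x * (16 * K)) ?_ ?_ ?_ ?_
  · refine Eventually.of_forall fun σ => Measurable.aestronglyMeasurable ?_
    exact (bumpRho_differentiable.continuous.measurable.mul (measurable_swapDefect
      (flow_lip hlip _).continuous (flow_lip hlip _).continuous)).const_mul _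
  · filter_upwards [Ioo_mem_nhdsGT (show (0 : ℝ) < 1 / 2 by norm_num)] with σ hσ
    refine Eventually.of_forall fun x => ?_
    rcases le_or_gt ‖x‖ 1 with hx | hx
    · have h1 := abs_swapDefect_le (flow w (t + σ)) (flow w (t - σ)) hx
      have e : |t + σ - (t - σ)| = 2 * σ := by
        rw [show t + σ - (t - σ) = 2 * σ by ring, abs_of_pos (by linarith [hσ.1])]
      have h2 := flow_time_lip_unit hlip h0 (s := t + σ) (t := t - σ)
        (by rw [e]; linarith [hσ.2]) hx
      rw [e] at h2
      rw [norm_mul, norm_mul, norm_inv, Real.norm_of_nonneg hσ.1.le,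
        Real.norm_of_nonneg (bumpRho_nonneg x), Real.norm_eq_abs, inv_mul_le_iff₀ hσ.1]
      calc _ ≤ bumpRho x * (2 * (4 * K * (2 * σ))) := by
            have := bumpRho_nonneg x
            gcongr
            linarith
        _ = _ := by ring
    · simp [bumpRho_zero_off hx.le]
  · exact bumpRho_lip.integrable_mul measurable_const _ fun x _ => le_rfl
  · filter_upwards [(hw.flow ht).2.2, hasDerivAt_flow hlip t, hasDerivAt_flow_symm hlip t 0]
      with x hx hd hd2
    rcases lt_or_ge ‖x‖ 1 with hx1 | hx1
    swap
    · simp [bumpRho_zero_off hx1]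
    by_cases hz : flow w t x = 0
    · have hdz : radialDefect (flow w t) x = 0 := by
        rw [radialDefect, hz, (hx hx1).2.2 hz]; simp
      have h1 : Tendsto (fun σ : ℝ => ‖σ‖⁻¹ * ‖flow w (t + σ) x - flow w (t - σ) x‖) (𝓝[>] 0)
          (𝓝 0) := by
        have := hasDerivAt_iff_tendsto.1 hd2
        simp only [add_zero, sub_zero, hdz, smul_zero, sub_self] at this
        exact this.mono_left nhdsWithin_le_nhds
      have h2 := (h1.const_mul (bumpRho x * 2))
      rw [mul_zero] at h2
      refine squeeze_zero_norm (fun σ => ?_) h2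
      rw [norm_mul, norm_mul, norm_inv, Real.norm_of_nonneg (bumpRho_nonneg x), Real.norm_eq_abs]
      have h3 := abs_swapDefect_le (flow w (t + σ)) (flow w (t - σ)) hx1.le
      calc _ ≤ |σ|⁻¹ * (bumpRho x * (2 * ‖flow w (t + σ) x - flow w (t - σ) x‖)) := by
            have := bumpRho_nonneg x
            rw [Real.norm_eq_abs]
            gcongr
        _ = _ := by ring
    · have hc := hd.continuousAt
      have c1 : Tendsto (fun σ : ℝ => t + σ) (𝓝[>] 0) (𝓝 t) := by
        have : Continuous (fun σ : ℝ => t + σ) := by fun_prop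
        simpa using (this.tendsto 0).mono_left nhdsWithin_le_nhds
      have c2 : Tendsto (fun σ : ℝ => t - σ) (𝓝[>] 0) (𝓝 t) := by
        have : Continuous (fun σ : ℝ => t - σ) := by fun_prop
        simpa using (this.tendsto 0).mono_left nhdsWithin_le_nhds
      refine tendsto_const_nhds.congr' ?_
      filter_upwards [c1.eventually (hc.eventually_ne hz), c2.eventually (hc.eventually_ne hz)]
        with σ n1 n2
      simp [swapDefect, n1, n2]

theorem hasDerivAt_energy_nonpos {n : ℕ} {K : NNReal} {w : En n → En n} (hw : FreeBdryField K w)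
    {t m : ℝ} (ht : 0 < t) (hm : HasDerivAt (fun s => energy (flow w s)) m t) : m ≤ 0 := by
  by_contra hpos
  push Not at hpos
  set Q' : ℝ → ℝ := fun σ => ∫ x, bumpRho x * (2 * inner ℝ (flow w (t + σ) x - flow w (t - σ) x)
        (radialDefect (flow w (t + σ)) x + radialDefect (flow w (t - σ)) x)) with hQ'
  have hlim : Tendsto (fun σ => σ⁻¹ * Q' σ) (𝓝[>] 0) (𝓝 (2 * (0 - 2 * m))) := by
    have h1 : HasDerivAt (fun σ => energy (flow w (t + σ)) - energy (flow w (t - σ))) (2 * m) 0 := by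
      have a := (show HasDerivAt (fun s => energy (flow w s)) m (t + 0) by simpa using hm).comp 0
        ((hasDerivAt_id (0 : ℝ)).const_add t)
      have b := (show HasDerivAt (fun s => energy (flow w s)) m (t - 0) by simpa using hm).comp 0
        ((hasDerivAt_id (0 : ℝ)).const_sub t)
      exact (a.sub b).congr_deriv (by ring)
    have h2 := h1.tendsto_slope_zero_right
    simp only [zero_add, add_zero, sub_zero, sub_self, smul_eq_mul] at h2
    refine (((tendsto_swapDefect_div hw ht.le).sub h2).const_mul 2).congr' ?_
    filter_upwards [Ioo_mem_nhdsGT ht] with σ hσ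
    have := energy_sub (hw.flow (t := t + σ) (by linarith [hσ.1]))
      (hw.flow (t := t - σ) (by linarith [hσ.2]))
    rw [this, integral_const_mul, hQ']
    simp only [mul_left_comm _ (2 : ℝ)]
    rw [integral_const_mul]
    ring
  have hneg : ∀ᶠ σ in 𝓝[>] (0 : ℝ), Q' σ < 0 := by
    filter_upwards [hlim.eventually (gt_mem_nhds (show 2 * (0 - 2 * m) < 0 by linarith)),
      self_mem_nhdsWithin] with σ h1 h2
    have h3 : 0 < σ⁻¹ := inv_pos.2 h2
    by_contra h
    push Not at h
    exact absurd h1 (not_lt.2 (mul_nonneg h3.le h))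
  obtain ⟨δ, hδ, hsub⟩ := mem_nhdsGT_iff_exists_Ioc_subset.1 hneg
  obtain ⟨c, hc, hc'⟩ := exists_hasDerivAt_eq_slope
    (fun σ => ∫ x, bumpRho x * ‖flow w (t + σ) x - flow w (t - σ) x‖ ^ 2) Q' hδ
    (fun σ _ => (hasDerivAt_symm_normSq hw.1 hw.2.1 t σ).continuousAt.continuousWithinAt)
    fun σ _ => hasDerivAt_symm_normSq hw.1 hw.2.1 t σ
  have h1 : Q' c < 0 := hsub ⟨hc.1, hc.2.le⟩
  have h2 : 0 ≤ ∫ x, bumpRho x * ‖flow w (t + δ) x - flow w (t - δ) x‖ ^ 2 :=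
    integral_nonneg fun x => mul_nonneg (bumpRho_nonneg x) (by positivity)
  rw [hc'] at h1
  simp only [add_zero, sub_zero, sub_self, norm_zero, ne_eq, OfNat.ofNat_ne_zero,
    not_false_eq_true, zero_pow, mul_zero, integral_zero] at h1
  exact absurd h1 (not_lt.2 (div_nonneg h2 (le_of_lt hδ)))

theorem antitoneOn_energy {n : ℕ} {K : NNReal} {w : En n → En n} (hw : FreeBdryField K w) :
    AntitoneOn (fun s => energy (flow w s)) (Set.Ioi 0) := by
  choose m hm using exists_hasDerivAt_energy hw.1 hw.2.1
  refine antitoneOn_of_deriv_nonpos (convex_Ioi 0)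
    (fun t _ => (hm t).continuousAt.continuousWithinAt)
    (fun t _ => (hm t).differentiableAt.differentiableWithinAt) fun t ht => ?_
  rw [interior_Ioi] at ht
  rw [(hm t).deriv]
  exact hasDerivAt_energy_nonpos hw ht (hm t)

/-- The weighted measure of the zero set of a field. -/
def zeroMass {n : ℕ} (w : En n → En n) : ℝ := ∫ x, bumpPhi x * {y | w y = 0}.indicator 1 x

theorem integrable_bumpPhi {n : ℕ} : Integrable (bumpPhi (n := n)) := by
  simpa using bumpPhi_lip.integrable_mul (n := n) (g := fun _ => 1) measurable_const 1
    fun x _ => by simp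

theorem integrable_bumpPhi_indicator {n : ℕ} {S : Set (En n)} (hS : MeasurableSet S) :
    Integrable (fun x => bumpPhi x * S.indicator 1 x) := by
  refine bumpPhi_lip.integrable_mul (measurable_one.indicator hS) 1 fun x _ => ?_
  by_cases h : x ∈ S <;> simp [h]

theorem measurableSet_zeros {n : ℕ} {K : NNReal} {w : En n → En n} (hw : LipschitzWith K w) :
    MeasurableSet {y | w y = 0} := (isClosed_eq hw.continuous continuous_const).measurableSet

theorem zeroMass_nonneg {n : ℕ} (w : En n → En n) : 0 ≤ zeroMass w := by
  refine integral_nonneg fun x => mul_nonneg (bumpPhi_nonneg x) ?_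
  exact Set.indicator_nonneg (fun _ _ => zero_le_one) x

theorem FreeBdryField.integral_rho_inner {n : ℕ} {K : NNReal} {w : En n → En n}
    (hw : FreeBdryField K w) :
    ∫ x, bumpRho x * inner ℝ x (w x) = (∫ x : En n, bumpPhi x) - zeroMass w := by
  have h := integral_bumpPhi_diverg hw.1
  have hm := measurableSet_zeros hw.1
  have e : ∫ x, (bumpPhi x * diverg w x - bumpRho x * inner ℝ x (w x)) =
      ∫ x, ((bumpPhi x - bumpPhi x * {y | w y = 0}.indicator 1 x)
        - bumpRho x * inner ℝ x (w x)) := by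
    refine integral_congr_ae ?_
    filter_upwards [hw.2.2] with x hx
    rcases lt_or_ge ‖x‖ 1 with h1 | h1
    · rw [diverg_eq_of_free (hx h1).2.1 (hx h1).2.2]
      by_cases h2 : w x = 0 <;> simp [h2]
    · simp [bumpPhi_zero_off h1]
  rw [e, integral_sub (integrable_lambda_sub integrable_bumpPhi (integrable_bumpPhi_indicator hm))
    (integrable_rho_inner_self hw.1 hw.2.1), integral_sub integrable_bumpPhi
    (integrable_bumpPhi_indicator hm)] at h
  rw [zeroMass]
  linarith

theorem energy_linear {n : ℕ} (A : En n →L[ℝ] En n) :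
    energy (fun x => A x) =
      (∫ x : En n, bumpPhi x) * LinearMap.trace ℝ (En n) (A : En n →ₗ[ℝ] En n) := by
  have h := integral_bumpPhi_diverg A.lipschitz
  have hd : ∀ x, diverg A x = LinearMap.trace ℝ (En n) (A : En n →ₗ[ℝ] En n) := fun x => by
    rw [diverg, A.fderiv]
  have hr : ∀ x, radialDefect A x = 0 := fun x => by rw [radialDefect, A.fderiv, sub_self]
  rw [energy_eq A.lipschitz (map_zero A)]
  simp only [hr, inner_zero_right, sub_zero]
  simp only [hd] at h
  rw [integral_sub (integrable_bumpPhi.mul_const _)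
    (integrable_rho_inner_self A.lipschitz (map_zero A)), integral_mul_const] at h
  linarith

theorem tendsto_energy {n : ℕ} {K : NNReal} {v : ℕ → En n → En n} {z : En n → En n}
    (hv : ∀ k, LipschitzWith K (v k)) (h0 : ∀ k, v k 0 = 0)
    (hlim : ∀ x, ‖x‖ ≤ 1 → Tendsto (fun k => v k x) atTop (𝓝 (z x))) :
    Tendsto (fun k => energy (v k)) atTop (𝓝 (energy z)) := by
  refine Tendsto.sub ?_ ?_
  · refine tendsto_integral_of_dominated_convergence (fun x => |bumpRho x| * K)
      (fun k => (integrable_rho_inner_self (hv k) (h0 k)).aestronglyMeasurable) ?_ ?_ ?_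
    · exact (bumpRho_lip.integrable_mul (g := fun _ => (K : ℝ)) measurable_const K fun x _ => by simp).norm.congr
        (Eventually.of_forall fun x => by simp)
    · refine fun k => Eventually.of_forall fun x => ?_
      rcases le_or_gt ‖x‖ 1 with hx | hx
      · rw [norm_mul, Real.norm_eq_abs]
        gcongr
        exact norm_inner_self_le hx (norm_le_one_of_lip (hv k) (h0 k) hx)
      · simp [bumpRho_zero_off hx.le]
    · refine Eventually.of_forall fun x => ?_
      rcases le_or_gt ‖x‖ 1 with hx | hx
      · exact (tendsto_const_nhds.inner (hlim x hx)).const_mul _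
      · simp [bumpRho_zero_off hx.le]
  · refine tendsto_integral_of_dominated_convergence (fun x => |bumpKappa x| * (K : ℝ) ^ 2)
      (fun k => ?_) ?_ ?_ ?_
    · exact (bumpKappa_lip.1.choose_spec.continuous.mul
        ((hv k).continuous.norm.pow 2)).aestronglyMeasurable
    · exact (bumpKappa_lip.integrable_mul (g := fun _ => (K : ℝ) ^ 2) measurable_const ((K : ℝ) ^ 2)
        fun x _ => by simp).norm.congr (Eventually.of_forall fun x => by simp)
    · refine fun k => Eventually.of_forall fun x => ?_
      rcases le_or_gt ‖x‖ 1 with hx | hx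
      · rw [norm_mul, norm_pow, norm_norm, Real.norm_eq_abs]
        have := norm_le_one_of_lip (hv k) (h0 k) hx
        gcongr
      · simp [bumpKappa_lip.2 x hx.le]
    · refine Eventually.of_forall fun x => ?_
      rcases le_or_gt ‖x‖ 1 with hx | hx
      · exact ((hlim x hx).norm.pow 2).const_mul _
      · simp [bumpKappa_lip.2 x hx.le]

theorem zeroMass_flow_le {n : ℕ} {K : NNReal} {w : En n → En n} (hw : LipschitzWith K w)
    {s : ℝ} (hs : 0 ≤ s) : zeroMass (flow w s) ≤ Real.exp (n * s) * zeroMass w := by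
  have hm := measurableSet_zeros hw
  have e : zeroMass (flow w s) = Real.exp (n * s) *
      ∫ x, bumpPhi (Real.exp s • x) * {y | w y = 0}.indicator 1 x := by
    have := Measure.integral_comp_smul (volume : Measure (En n))
      (fun x => bumpPhi (Real.exp s • x) * {y | w y = 0}.indicator 1 x) (Real.exp (-s))
    rw [finrank_euclideanSpace_fin, ← Real.exp_nat_mul, ← Real.exp_neg,
      abs_of_pos (Real.exp_pos _), smul_eq_mul] at this
    rw [show (n : ℝ) * s = -(n * -s) by ring, ← this, zeroMass]
    refine integral_congr_ae (Eventually.of_forall fun x => ?_)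
    simp only [smul_smul, ← Real.exp_add, add_neg_cancel, Real.exp_zero, one_smul]
    congr 1
    simp [Set.indicator_apply, flow, Real.exp_ne_zero]
  rw [e]
  refine mul_le_mul_of_nonneg_left ?_ (Real.exp_nonneg _)
  have hle : ∀ x : En n, bumpPhi (Real.exp s • x) ≤ bumpPhi x := fun x => by
    refine bumpPhi_anti ?_
    rw [norm_smul, Real.norm_of_nonneg (Real.exp_nonneg _)]
    have : 1 ≤ Real.exp s := Real.one_le_exp hs
    nlinarith [norm_nonneg x]
  have hind : ∀ x, (0 : ℝ) ≤ {y | w y = 0}.indicator 1 x := fun x =>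
    Set.indicator_nonneg (fun _ _ => zero_le_one) x
  refine integral_mono_of_nonneg
    (Eventually.of_forall fun x => mul_nonneg (bumpPhi_nonneg _) (hind x))
    (integrable_bumpPhi_indicator hm)
    (Eventually.of_forall fun x => mul_le_mul_of_nonneg_right (hle x) (hind x))

theorem le_energy_flow {n : ℕ} {K : NNReal} {w : En n → En n} (hw : FreeBdryField K w)
    {A : En n →L[ℝ] En n} (hA : LinearMap.trace ℝ (En n) (A : En n →ₗ[ℝ] En n) = 1)
    {τ : ℕ → ℝ} (hτ : Tendsto τ atTop atTop)
    (hlim : ∀ x, ‖x‖ ≤ 1 → Tendsto (fun k => flow w (τ k) x) atTop (𝓝 (A x)))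
    {t : ℝ} (ht : 0 < t) : ∫ x : En n, bumpPhi x ≤ energy (flow w t) := by
  have h := tendsto_energy (fun k => flow_lip hw.1 (τ k)) (fun k => flow_zero_right hw.2.1 _) hlim
  rw [energy_linear, hA, mul_one] at h
  refine le_of_tendsto h ?_
  filter_upwards [hτ.eventually_ge_atTop t] with k hk
  exact antitoneOn_energy hw ht (ht.trans_le hk) hk

theorem tendsto_zeroMass {n : ℕ} {K : NNReal} {w : En n → En n} (hw : FreeBdryField K w)
    {A : En n →L[ℝ] En n} (hA : LinearMap.trace ℝ (En n) (A : En n →ₗ[ℝ] En n) = 1)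
    {τ : ℕ → ℝ} (hτ : Tendsto τ atTop atTop)
    (hlim : ∀ x, ‖x‖ ≤ 1 → Tendsto (fun k => flow w (τ k) x) atTop (𝓝 (A x))) :
    Tendsto (fun t => zeroMass (flow w t)) atTop (𝓝 0) := by
  set h : ℝ → ℝ := fun t => ∫ x, bumpRho x * ‖flow w t x‖ ^ 2 with hh
  have hd : ∀ t, 0 < t → ∃ d, HasDerivAt h d t ∧ d ≤ -2 * zeroMass (flow w t) := by
    intro t ht
    refine ⟨_, hasDerivAt_weighted_normSq_flow hw.1 hw.2.1 bumpRho_lip t, ?_⟩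
    have hf := hw.flow ht.le
    have h1 := le_energy_flow hw hA hτ hlim ht
    have h2 := hf.integral_rho_inner
    have m := hf.1.continuous.measurable
    have i1 := integrable_rho_inner_self hf.1 hf.2.1
    have i2 : Integrable fun x => bumpRho x *
        inner ℝ (flow w t x) (radialDefect (flow w t) x) :=
      bumpRho_lip.integrable_mul (m.inner (measurable_radialDefect hf.1)) _ fun x hx =>
        norm_inner_le_of_le (norm_flow_le hw.1 hw.2.1 t hx)
          (norm_radialDefect_le hf.1 hf.2.1 hx)
    rw [energy_eq hf.1 hf.2.1] at h1
    simp only [mul_sub] at h1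
    rw [integral_sub i1 i2] at h1
    simp only [mul_left_comm _ (2 : ℝ)]
    rw [integral_const_mul]
    linarith
  have hanti : ∀ s t, 0 < s → s < t → ∃ c ∈ Set.Ioo s t,
      2 * zeroMass (flow w c) * (t - s) ≤ h s - h t := by
    intro s t hs hst
    choose! d hd1 hd2 using hd
    obtain ⟨c, hc, hc'⟩ := exists_hasDerivAt_eq_slope h d hst
      (fun x hx => (hd1 x (hs.trans_le hx.1)).continuousAt.continuousWithinAt)
      fun x hx => hd1 x (hs.trans hx.1)
    refine ⟨c, hc, ?_⟩
    have h1 := hd2 c (hs.trans hc.1)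
    rw [hc', div_le_iff₀ (by linarith)] at h1
    linarith
  have hnn : ∀ t, 0 ≤ h t := fun t =>
    integral_nonneg fun x => mul_nonneg (bumpRho_nonneg x) (by positivity)
  have hA2 : Antitone fun t => h (max t 1) := by
    intro s t hst
    rcases (max_le_max_right 1 hst).eq_or_lt with he | he
    · simp only [he, le_refl]
    · obtain ⟨c, -, hc⟩ := hanti _ _ (lt_max_of_lt_right one_pos) he
      have := zeroMass_nonneg (flow w c)
      have : 0 ≤ 2 * zeroMass (flow w c) * (max t 1 - max s 1) :=
        mul_nonneg (by linarith) (by linarith)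
      show h (max t 1) ≤ h (max s 1)
      linarith
  have hl := tendsto_atTop_ciInf hA2 ⟨0, by rintro _ ⟨t, rfl⟩; exact hnn _⟩
  have hl2 := ((hl.comp (tendsto_atTop_add_const_right atTop (-1 : ℝ) tendsto_id)).sub
    hl).const_mul (Real.exp n)
  rw [sub_self, mul_zero] at hl2
  refine squeeze_zero' (Eventually.of_forall fun t => zeroMass_nonneg _) ?_ hl2
  filter_upwards [eventually_ge_atTop (2 : ℝ)] with t ht
  obtain ⟨c, hc, hc'⟩ := hanti (t - 1) t (by linarith) (by linarith)
  have h1 := zeroMass_flow_le (flow_lip hw.1 c) (s := t - c) (by linarith [hc.2])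
  rw [flow_flow, add_sub_cancel] at h1
  have h2 : Real.exp (n * (t - c)) ≤ Real.exp n := by
    refine Real.exp_le_exp.2 (mul_le_of_le_one_right (by positivity) (by linarith [hc.1]))
  have h3 := zeroMass_nonneg (flow w c)
  simp only [Function.comp, id]
  rw [max_eq_left (by linarith : (1 : ℝ) ≤ t), max_eq_left (by linarith : (1 : ℝ) ≤ t + -1),
    ← sub_eq_add_neg]
  refine h1.trans (mul_le_mul h2 (by linarith) h3 (Real.exp_nonneg _))

/-- The total mass of the mollifier. -/
def rhoMass (n : ℕ) : ℝ := ∫ x : En n, bumpRho x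

theorem integrable_bumpRho {n : ℕ} : Integrable (bumpRho (n := n)) := by
  simpa using bumpRho_lip.integrable_mul (n := n) (g := fun _ => 1) measurable_const 1
    fun x _ => by simp

theorem rhoMass_pos {n : ℕ} (hn : 0 < n) : 0 < rhoMass n := by
  have hφ : 0 < ∫ x : En n, bumpPhi x :=
    bumpPhi_contDiff.continuous.integral_pos_of_hasCompactSupport_nonneg_nonzero
      bumpPhi_lip.hasCompactSupport bumpPhi_nonneg (x := 0) (bumpPhi_pos (by simp)).ne'
  have h1 := energy_linear (ContinuousLinearMap.id ℝ (En n))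
  have h2 := integral_bumpPhi_diverg (LipschitzWith.id (α := En n))
  have i := integrable_rho_inner_self (LipschitzWith.id (α := En n)) rfl
  have hd : ∀ x : En n, diverg id x = n := diverg_id
  simp only [hd] at h2
  rw [integral_sub (integrable_bumpPhi.mul_const _) i, integral_mul_const] at h2
  have h3 : ∫ x : En n, bumpRho x * inner ℝ x (id x) ≤ rhoMass n := by
    refine integral_mono i integrable_bumpRho fun x => ?_
    rcases le_or_gt ‖x‖ 1 with hx | hx
    · refine mul_le_of_le_one_right (bumpRho_nonneg x) ?_
      rw [id, real_inner_self_eq_norm_sq]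
      exact pow_le_one₀ (norm_nonneg x) hx
    · simp [bumpRho_zero_off hx.le]
  have : 0 < (∫ x : En n, bumpPhi x) * n := by positivity
  linarith

/-- The average of a field over a ball, with the radial weight. -/
def mollify {n : ℕ} (v : En n → En n) (s : ℝ) (x : En n) : En n :=
  ∫ y, bumpRho y • v (x + s • y)

theorem lipschitz_affine {n : ℕ} {K : NNReal} {v : En n → En n} (hv : LipschitzWith K v)
    (x : En n) (s : ℝ) : LipschitzWith (K * ‖s‖₊) (fun y => v (x + s • y)) := by
  refine LipschitzWith.of_dist_le_mul fun y z => ?_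
  refine (hv.dist_le_mul _ _).trans_eq ?_
  rw [dist_add_left, dist_smul₀, NNReal.coe_mul, coe_nnnorm, mul_assoc]

theorem fderiv_affine {n : ℕ} (v : En n → En n) (x : En n) (s : ℝ) (y : En n) :
    fderiv ℝ (fun y => v (x + s • y)) y = s • fderiv ℝ v (x + s • y) := by
  rw [fderiv_comp_smul (f := fun y => v (x + y)) s, fderiv_comp_add_left]

theorem continuous_affine {n : ℕ} {K : NNReal} {v : En n → En n} (hv : LipschitzWith K v)
    (x : En n) (s : ℝ) : Continuous (fun y => v (x + s • y)) := (lipschitz_affine hv x s).continuous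

theorem norm_affine_le {n : ℕ} {K : NNReal} {v : En n → En n} (hv : LipschitzWith K v)
    (h0 : v 0 = 0) (x : En n) (s : ℝ) {y : En n} (hy : ‖y‖ ≤ 1) :
    ‖v (x + s • y)‖ ≤ K * (‖x‖ + |s|) := by
  refine (norm_le_of_lip hv h0 _).trans ?_
  refine mul_le_mul_of_nonneg_left ((norm_add_le _ _).trans ?_) K.2
  rw [norm_smul, Real.norm_eq_abs]
  have := mul_le_of_le_one_right (abs_nonneg s) hy
  linarith

theorem integrable_mollify {n : ℕ} {K : NNReal} {v : En n → En n} (hv : LipschitzWith K v)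
    (h0 : v 0 = 0) (s : ℝ) (x : En n) : Integrable (fun y => bumpRho y • v (x + s • y)) :=
  bumpRho_lip.integrable_smul (continuous_affine hv x s).aestronglyMeasurable _
    fun _ hy => norm_affine_le hv h0 x s hy

theorem inner_mollify {n : ℕ} {K : NNReal} {v : En n → En n} (hv : LipschitzWith K v)
    (h0 : v 0 = 0) (s : ℝ) (x e : En n) :
    inner ℝ e (mollify v s x) = ∫ y, bumpRho y * inner ℝ e (v (x + s • y)) := by
  rw [mollify, ← integral_inner (integrable_mollify hv h0 s x)]
  simp only [inner_smul_right]

theorem norm_mollify_sub_le {n : ℕ} {K : NNReal} {v : En n → En n} (hv : LipschitzWith K v)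
    (h0 : v 0 = 0) {s : ℝ} (hs : 0 ≤ s) (x : En n) :
    ‖mollify v s x - rhoMass n • v x‖ ≤ K * s * rhoMass n := by
  have e : rhoMass n • v x = ∫ y, bumpRho y • v x := (integral_smul_const _ _).symm
  rw [e, mollify, ← integral_sub (integrable_mollify hv h0 s x) (integrable_bumpRho.smul_const _),
    rhoMass, ← integral_const_mul]
  refine norm_integral_le_of_norm_le (integrable_bumpRho.const_mul _)
    (Eventually.of_forall fun y => ?_)
  rcases le_or_gt ‖y‖ 1 with hy | hy
  · rw [← smul_sub, norm_smul, Real.norm_of_nonneg (bumpRho_nonneg y), mul_comm]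
    refine mul_le_mul_of_nonneg_right ((hv.norm_sub_le _ _).trans ?_) (bumpRho_nonneg y)
    rw [add_sub_cancel_left, norm_smul, Real.norm_of_nonneg hs]
    exact mul_le_mul_of_nonneg_left (mul_le_of_le_one_right hs hy) K.2
  · simp [bumpRho_zero_off hy.le]

theorem norm_le_of_abs_inner_le {n : ℕ} {d : En n} {D : ℝ} (hD : 0 ≤ D)
    (h : ∀ e, |(inner ℝ e d : ℝ)| ≤ ‖e‖ * D) : ‖d‖ ≤ D := by
  have h1 := h d
  rw [real_inner_self_eq_norm_sq, abs_of_nonneg (by positivity), pow_two] at h1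
  rcases (norm_nonneg d).eq_or_lt with h2 | h2
  · rw [← h2]; exact hD
  · exact le_of_mul_le_mul_left h1 h2

theorem integral_comp_affine {n : ℕ} (F : En n → ℝ) (x : En n) {s : ℝ} (hs : 0 < s) :
    ∫ y, F (x + s • y) = (s ^ n)⁻¹ * ∫ y, F y := by
  have := Measure.integral_comp_smul (volume : Measure (En n)) (fun y => F (x + y)) s
  rw [finrank_euclideanSpace_fin, abs_of_pos (by positivity), smul_eq_mul,
    integral_add_left_eq_self] at this
  exact this

theorem exists_bumpRho_indicator_le (n : ℕ) : ∃ C : ℝ, 0 ≤ C ∧ ∀ (K : NNReal) (v : En n → En n),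
    LipschitzWith K v → ∀ x : En n, ‖x‖ ≤ 1 / 4 → ∀ s, 0 < s → s ≤ 1 / 4 →
    ∫ y, bumpRho y * {y | v y = 0}.indicator 1 (x + s • y) ≤ C * ((s ^ n)⁻¹ * zeroMass v) := by
  obtain ⟨R, hR, hR'⟩ := bumpRho_lip.exists_bound (n := n)
  set c := expNegInvGlue (3 / 4) with hc
  have hc0 : 0 < c := expNegInvGlue.pos_of_pos (by norm_num)
  refine ⟨R / c, by positivity, fun K v hv x hx s hs hs' => ?_⟩
  have hm := measurableSet_zeros hv
  have hi : Integrable fun y => bumpPhi (x + s • y) * {y | v y = 0}.indicator 1 (x + s • y) := by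
    have := (integrable_bumpPhi_indicator hm).comp_add_left x
    exact (integrable_comp_smul_iff volume _ hs.ne').2 this
  rw [zeroMass, ← integral_comp_affine _ x hs, ← integral_const_mul]
  have hind : ∀ y, (0 : ℝ) ≤ {y | v y = 0}.indicator 1 y := fun y =>
    Set.indicator_nonneg (fun _ _ => zero_le_one) y
  refine integral_mono_of_nonneg
    (Eventually.of_forall fun y => mul_nonneg (bumpRho_nonneg y) (hind _)) (hi.const_mul _)
    (Eventually.of_forall fun y => ?_)
  rcases le_or_gt ‖y‖ 1 with hy | hy
  · have h1 : ‖x + s • y‖ ≤ 1 / 2 := by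
      refine (norm_add_le _ _).trans ?_
      rw [norm_smul, Real.norm_of_nonneg hs.le]
      nlinarith [norm_nonneg y]
    have h2 : c ≤ bumpPhi (x + s • y) :=
      expNegInvGlue.monotone (by nlinarith [norm_nonneg (x + s • y)])
    have h3 : bumpRho y ≤ R := (le_abs_self _).trans (hR' y)
    calc _ ≤ R * {y | v y = 0}.indicator 1 (x + s • y) :=
          mul_le_mul_of_nonneg_right h3 (hind _)
      _ = R / c * (c * {y | v y = 0}.indicator 1 (x + s • y)) := by field_simp
      _ ≤ _ := by
          exact mul_le_mul_of_nonneg_left (mul_le_mul_of_nonneg_right h2 (hind _)) (by positivity)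
  · simp only [bumpRho_zero_off hy.le, zero_mul]
    exact mul_nonneg (by positivity) (mul_nonneg (bumpPhi_nonneg _) (hind _))

theorem FreeBdryField.affine {n : ℕ} {K : NNReal} {v : En n → En n} (hv : FreeBdryField K v)
    {x : En n} (hx : ‖x‖ ≤ 1 / 4) {s : ℝ} (hs : 0 < s) (hs' : s ≤ 1 / 4) :
    ∀ᵐ y, ‖y‖ < 1 →
      (∀ a b, inner ℝ (fderiv ℝ v (x + s • y) a) b = inner ℝ a (fderiv ℝ v (x + s • y) b)) ∧
      diverg v (x + s • y) = 1 - {y | v y = 0}.indicator 1 (x + s • y) := by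
  filter_upwards [ae_comp_smul hv.2.2 x hs.ne'] with y hy hy1
  have h1 : ‖x + s • y‖ < 1 := by
    refine (norm_add_le _ _).trans_lt ?_
    rw [norm_smul, Real.norm_of_nonneg hs.le]
    nlinarith [norm_nonneg y]
  obtain ⟨a, b, c⟩ := hy h1
  refine ⟨a, ?_⟩
  rw [diverg_eq_of_free b c]
  by_cases h2 : v (x + s • y) = 0 <;> simp [h2]

theorem hasDerivAt_mollify_scale {n : ℕ} {K : NNReal} {v : En n → En n} (hv : LipschitzWith K v)
    (h0 : v 0 = 0) (x e : En n) {s : ℝ} (hs : s ≠ 0) :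
    HasDerivAt (fun s => inner ℝ e (mollify v s x))
      (∫ y, bumpRho y * inner ℝ e (fderiv ℝ v (x + s • y) y)) s := by
  simp only [inner_mollify hv h0]
  have hae := ae_comp_smul hv.ae_differentiableAt x hs
  refine hasDerivAt_integral_bump bumpRho_lip
    (fun s => continuous_const.inner (continuous_affine hv x s))
    (measurable_const.inner (isBoundedBilinearMap_apply.continuous.measurable.comp
      (((measurable_fderiv ℝ v).comp (by fun_prop : Measurable fun y : En n => x + s • y)).prodMk
        measurable_id))) (‖e‖ * (K * (‖x‖ + |s|))) (‖e‖ * K) (by positivity)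
    (fun y hy => norm_inner_le_of_le le_rfl (norm_affine_le hv h0 x s hy))
    (fun y hy a b _ _ => ?_) ?_
  · rw [← inner_sub_right, mul_assoc]
    refine norm_inner_le_of_le le_rfl ((hv.norm_sub_le _ _).trans ?_)
    rw [add_sub_add_left_eq_sub, ← sub_smul, norm_smul, Real.norm_eq_abs]
    exact mul_le_mul_of_nonneg_left (mul_le_of_le_one_right (abs_nonneg _) hy) K.2
  · filter_upwards [hae] with y hy
    have h1 : HasDerivAt (fun s : ℝ => x + s • y) y s := by
      simpa using ((hasDerivAt_id s).smul_const y).const_add x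
    simpa using (hasDerivAt_const s e).inner ℝ (hy.hasFDerivAt.comp_hasDerivAt s h1)

theorem integral_rho_inner_const {n : ℕ} (e : En n) : ∫ y : En n, bumpRho y * inner ℝ y e = 0 := by
  have h := integral_bumpPhi_diverg (LipschitzWith.const (α := En n) e)
  have hd : ∀ x : En n, diverg (fun _ => e) x = 0 := fun x => by simp [diverg]
  simpa [hd, integral_neg] using h

theorem FreeBdryField.deriv_mollify_eq {n : ℕ} {K : NNReal} {v : En n → En n}
    (hv : FreeBdryField K v) {x : En n} (hx : ‖x‖ ≤ 1 / 4) {s : ℝ} (hs : 0 < s) (hs' : s ≤ 1 / 4)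
    (e : En n) : ∫ y, bumpRho y * inner ℝ e (fderiv ℝ v (x + s • y) y) =
      -∫ y, bumpRho y * ({y | v y = 0}.indicator 1 (x + s • y) * inner ℝ y e) := by
  have haff := hv.affine hx hs hs'
  have h := integral_bump_exchange (LipschitzWith.const (α := En n) e) (lipschitz_affine hv.1 x s)
    (Eventually.of_forall fun y _ a b => by simp) (by
      filter_upwards [haff] with y hy hy1 a b
      rw [fderiv_affine]
      simp [inner_smul_left, inner_smul_right, (hy hy1).1])
  have hm : Measurable fun y => {y | v y = 0}.indicator (1 : En n → ℝ) (x + s • y) :=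
    (measurable_one.indicator (measurableSet_zeros hv.1)).comp (by fun_prop)
  have i1 : Integrable fun y => bumpRho y * inner ℝ e (fderiv ℝ v (x + s • y) y) := by
    refine bumpRho_lip.integrable_mul
      (measurable_const.inner (isBoundedBilinearMap_apply.continuous.measurable.comp
      (((measurable_fderiv ℝ v).comp (by fun_prop : Measurable fun y : En n => x + s • y)).prodMk
        measurable_id))) (‖e‖ * K) fun y hy => norm_inner_le_of_le le_rfl ?_
    exact ((fderiv ℝ v _).le_opNorm y).trans ((mul_le_of_le_one_right (norm_nonneg _) hy).trans
      (norm_fderiv_le_of_lipschitz ℝ hv.1))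
  have i2 : Integrable fun y =>
      bumpRho y * ({y | v y = 0}.indicator 1 (x + s • y) * inner ℝ y e) := by
    refine bumpRho_lip.integrable_mul (hm.mul (measurable_id.inner measurable_const)) (1 * ‖e‖)
      fun y hy => ?_
    rw [norm_mul]
    refine mul_le_mul ?_ (norm_inner_self_le hy le_rfl) (norm_nonneg _) zero_le_one
    by_cases h2 : v (x + s • y) = 0 <;> simp [h2]
  have i3 : Integrable fun y : En n => bumpRho y * inner ℝ y e :=
    bumpRho_lip.integrable_mul (measurable_id.inner measurable_const) ‖e‖
      fun y hy => norm_inner_self_le hy le_rfl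
  have e1 : (0 : ℝ) = ∫ y, s * ((bumpRho y * inner ℝ e (fderiv ℝ v (x + s • y) y) +
      bumpRho y * ({y | v y = 0}.indicator 1 (x + s • y) * inner ℝ y e)) -
        bumpRho y * inner ℝ y e) := by
    rw [← h]
    refine integral_congr_ae ?_
    filter_upwards [haff] with y hy
    rcases lt_or_ge ‖y‖ 1 with hy1 | hy1
    · have hd : diverg (fun y => v (x + s • y)) y
          = s * (1 - {y | v y = 0}.indicator 1 (x + s • y)) := by
        rw [← (hy hy1).2, diverg, fderiv_affine]
        simp [diverg]
      rw [hd, fderiv_affine]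
      simp only [diverg, fderiv_fun_const, Pi.zero_apply, ContinuousLinearMap.toLinearMap_zero,
        map_zero, _root_.zero_apply, inner_zero_right, _root_.smul_apply,
        inner_smul_right]
      ring
    · simp [bumpRho_zero_off hy1]
  have i12 : Integrable fun y => bumpRho y * inner ℝ e (fderiv ℝ v (x + s • y) y) +
      bumpRho y * ({y | v y = 0}.indicator 1 (x + s • y) * inner ℝ y e) := i1.add i2
  rw [integral_const_mul, integral_sub i12 i3, integral_add i1 i2, integral_rho_inner_const,
    sub_zero, eq_comm, mul_eq_zero] at e1
  have := e1.resolve_left hs.ne'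
  linarith

theorem abs_integral_rho_indicator_inner_le {n : ℕ} {K : NNReal} {v : En n → En n}
    (hv : LipschitzWith K v) (x e : En n) (s : ℝ) :
    |∫ y, bumpRho y * ({y | v y = 0}.indicator 1 (x + s • y) * inner ℝ y e)| ≤
      ‖e‖ * ∫ y, bumpRho y * {y | v y = 0}.indicator 1 (x + s • y) := by
  have hind : ∀ y, (0 : ℝ) ≤ {y | v y = 0}.indicator 1 y := fun y =>
    Set.indicator_nonneg (fun _ _ => zero_le_one) y
  rw [← integral_const_mul]
  refine norm_integral_le_of_norm_le (f := fun y => bumpRho y *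
    ({y | v y = 0}.indicator 1 (x + s • y) * (inner ℝ y e : ℝ))) (Integrable.const_mul ?_ _)
    (Eventually.of_forall fun y => ?_)
  · refine bumpRho_lip.integrable_mul ?_ 1 fun y _ => ?_
    · exact (measurable_one.indicator (measurableSet_zeros hv)).comp
        (by fun_prop : Measurable fun y : En n => x + s • y)
    · rw [Real.norm_of_nonneg (hind _)]
      exact Set.indicator_le_self' (fun _ _ => zero_le_one) _
  · rcases le_or_gt ‖y‖ 1 with hy | hy
    · rw [norm_mul, norm_mul, Real.norm_of_nonneg (bumpRho_nonneg y), Real.norm_of_nonneg (hind _)]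
      have h1 : ‖(inner ℝ y e : ℝ)‖ ≤ ‖e‖ :=
        (norm_inner_le_norm y e).trans (mul_le_of_le_one_left (norm_nonneg _) hy)
      calc _ ≤ bumpRho y * ({y | v y = 0}.indicator 1 (x + s • y) * ‖e‖) :=
            mul_le_mul_of_nonneg_left (mul_le_mul_of_nonneg_left h1 (hind _)) (bumpRho_nonneg y)
        _ = _ := by ring
    · simp [bumpRho_zero_off hy.le]

/-- Away from the zero set the mollification hardly depends on the scale. -/
theorem exists_norm_mollify_sub_le (n : ℕ) : ∃ C : ℝ, 0 ≤ C ∧ ∀ (K : NNReal) (v : En n → En n),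
    FreeBdryField K v → ∀ x : En n, ‖x‖ ≤ 1 / 4 → ∀ s, 0 < s → s ≤ 1 / 4 →
    ‖mollify v (1 / 4) x - mollify v s x‖ ≤ C * ((s ^ n)⁻¹ * zeroMass v) := by
  obtain ⟨C, hC, hC'⟩ := exists_bumpRho_indicator_le n
  refine ⟨C, hC, fun K v hv x hx s hs hs' => ?_⟩
  have hD : 0 ≤ C * ((s ^ n)⁻¹ * zeroMass v) :=
    mul_nonneg hC (mul_nonneg (by positivity) (zeroMass_nonneg _))
  refine norm_le_of_abs_inner_le hD fun e => ?_
  have := (convex_Icc s (1 / 4)).norm_image_sub_le_of_norm_hasDerivWithin_le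
    (f := fun s => (inner ℝ e (mollify v s x) : ℝ)) (C := ‖e‖ * (C * ((s ^ n)⁻¹ * zeroMass v)))
    (fun r hr => (hasDerivAt_mollify_scale hv.1 hv.2.1 x e
      (hs.trans_le hr.1).ne').hasDerivWithinAt) (fun r hr => ?_)
    (Set.left_mem_Icc.2 hs') (Set.right_mem_Icc.2 hs')
  · rw [inner_sub_right, ← Real.norm_eq_abs]
    refine this.trans (mul_le_of_le_one_right (by positivity) ?_)
    rw [Real.norm_eq_abs, abs_le]; constructor <;> linarith
  · have hr0 := hs.trans_le hr.1
    rw [hv.deriv_mollify_eq hx hr0 hr.2, norm_neg, Real.norm_eq_abs]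
    refine (abs_integral_rho_indicator_inner_le hv.1 x e r).trans
      (mul_le_mul_of_nonneg_left ((hC' K v hv.1 x hx r hr0 hr.2).trans ?_) (norm_nonneg e))
    have := zeroMass_nonneg v
    have := hr.1
    gcongr

/-- The averaged derivative at the origin. -/
def meanDeriv {n : ℕ} (v : En n → En n) : En n →L[ℝ] En n :=
  ∫ y, bumpRho y • fderiv ℝ v ((0 : En n) + (1 / 4 : ℝ) • y)

theorem integrable_meanDeriv {n : ℕ} {K : NNReal} {v : En n → En n} (hv : LipschitzWith K v) :
    Integrable (fun y => bumpRho y • fderiv ℝ v ((0 : En n) + (1 / 4 : ℝ) • y)) :=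
  bumpRho_lip.integrable_smul (((measurable_fderiv ℝ v).comp
    (by fun_prop : Measurable fun y : En n => (0 : En n) + (1 / 4 : ℝ) • y)).aestronglyMeasurable) K
    fun _ _ => norm_fderiv_le_of_lipschitz ℝ hv

theorem meanDeriv_apply {n : ℕ} {K : NNReal} {v : En n → En n} (hv : LipschitzWith K v)
    (x e : En n) : inner ℝ e (meanDeriv v x) =
      ∫ y, bumpRho y * inner ℝ e (fderiv ℝ v ((0 : En n) + (1 / 4 : ℝ) • y) x) := by
  have hi := integrable_meanDeriv hv
  rw [meanDeriv, ContinuousLinearMap.integral_apply hi, ← integral_inner (hi.apply_continuousLinearMap x)]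
  simp [inner_smul_right]

theorem meanDeriv_symm {n : ℕ} {K : NNReal} {v : En n → En n} (hv : FreeBdryField K v)
    (a b : En n) : inner ℝ (meanDeriv v a) b = inner ℝ a (meanDeriv v b) := by
  rw [real_inner_comm, meanDeriv_apply hv.1, meanDeriv_apply hv.1]
  refine integral_congr_ae ?_
  filter_upwards [hv.affine (x := 0) (by simp) (by norm_num : (0 : ℝ) < 1 / 4) le_rfl] with y hy
  rcases lt_or_ge ‖y‖ 1 with h | h
  · simp only [← (hy h).1 a b, real_inner_comm]
  · simp [bumpRho_zero_off h]

theorem exists_abs_trace_meanDeriv_sub_le (n : ℕ) : ∃ C : ℝ, 0 ≤ C ∧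
    ∀ (K : NNReal) (v : En n → En n), FreeBdryField K v →
    |LinearMap.trace ℝ (En n) (meanDeriv v : En n →ₗ[ℝ] En n) - rhoMass n| ≤ C * zeroMass v := by
  obtain ⟨C, hC, hC'⟩ := exists_bumpRho_indicator_le n
  refine ⟨C * (((1 / 4 : ℝ) ^ n)⁻¹), by positivity, fun K v hv => ?_⟩
  have hind : ∀ y, (0 : ℝ) ≤ {y | v y = 0}.indicator 1 y := fun y =>
    Set.indicator_nonneg (fun _ _ => zero_le_one) y
  let L : (En n →L[ℝ] En n) →L[ℝ] ℝ := LinearMap.toContinuousLinearMap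
    ((LinearMap.trace ℝ (En n)) ∘ₗ (ContinuousLinearMap.coeLM ℝ))
  have hL : ∀ A : En n →L[ℝ] En n, L A = LinearMap.trace ℝ (En n) (A : En n →ₗ[ℝ] En n) :=
    fun A => rfl
  have hi := integrable_meanDeriv hv.1
  have hint : Integrable fun y : En n =>
      bumpRho y * {y | v y = 0}.indicator 1 ((0 : En n) + (1 / 4 : ℝ) • y) := by
    refine bumpRho_lip.integrable_mul ?_ 1 fun y _ => ?_
    · exact (measurable_one.indicator (measurableSet_zeros hv.1)).comp
        (by fun_prop : Measurable fun y : En n => (0 : En n) + (1 / 4 : ℝ) • y)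
    · rw [Real.norm_of_nonneg (hind _)]
      exact Set.indicator_le_self' (fun _ _ => zero_le_one) _
  have h1 : L (meanDeriv v) = rhoMass n -
      ∫ y, bumpRho y * {y | v y = 0}.indicator 1 ((0 : En n) + (1 / 4 : ℝ) • y) := by
    rw [meanDeriv, ← L.integral_comp_comm hi, rhoMass, ← integral_sub integrable_bumpRho hint]
    refine integral_congr_ae ?_
    filter_upwards [hv.affine (x := 0) (by simp) (by norm_num : (0 : ℝ) < 1 / 4) le_rfl] with y hy
    rw [map_smul, hL, smul_eq_mul]
    rcases lt_or_ge ‖y‖ 1 with h | h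
    · have := (hy h).2
      rw [diverg] at this
      rw [this]; ring
    · simp [bumpRho_zero_off h]
  have h2 := hC' K v hv.1 0 (by simp) (1 / 4) (by norm_num) le_rfl
  have h3 : 0 ≤ ∫ y, bumpRho y * {y | v y = 0}.indicator 1 ((0 : En n) + (1 / 4 : ℝ) • y) :=
    integral_nonneg fun y => mul_nonneg (bumpRho_nonneg y) (hind _)
  rw [← hL, h1, sub_sub_cancel_left, abs_neg, abs_of_nonneg h3, mul_assoc]
  exact h2

theorem hasDerivAt_mollify_translate {n : ℕ} {K : NNReal} {v : En n → En n}
    (hv : LipschitzWith K v) (h0 : v 0 = 0) (x e : En n) (θ : ℝ) :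
    HasDerivAt (fun θ : ℝ => inner ℝ e (mollify v (1 / 4) (θ • x)))
      (∫ y, bumpRho y * inner ℝ e (fderiv ℝ v (θ • x + (1 / 4 : ℝ) • y) x)) θ := by
  simp only [inner_mollify hv h0]
  have hae := ae_comp_smul hv.ae_differentiableAt (θ • x) (by norm_num : (1 / 4 : ℝ) ≠ 0)
  refine hasDerivAt_integral_bump bumpRho_lip
    (fun θ => continuous_const.inner (continuous_affine hv (θ • x) (1 / 4)))
    (measurable_const.inner (isBoundedBilinearMap_apply.continuous.measurable.comp
      (((measurable_fderiv ℝ v).comp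
        (by fun_prop : Measurable fun y : En n => θ • x + (1 / 4 : ℝ) • y)).prodMk
        measurable_const))) (‖e‖ * (K * (‖θ • x‖ + |1 / 4|))) (‖e‖ * (K * ‖x‖)) (by positivity)
    (fun y hy => norm_inner_le_of_le le_rfl (norm_affine_le hv h0 (θ • x) (1 / 4) hy))
    (fun y hy a b _ _ => ?_) ?_
  · rw [← inner_sub_right, mul_assoc]
    refine norm_inner_le_of_le le_rfl ((hv.norm_sub_le _ _).trans_eq ?_)
    rw [add_sub_add_right_eq_sub, ← sub_smul, norm_smul, Real.norm_eq_abs]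
    ring
  · filter_upwards [hae] with y hy
    have h1 : HasDerivAt (fun θ : ℝ => θ • x + (1 / 4 : ℝ) • y) x θ := by
      simpa using ((hasDerivAt_id θ).smul_const x).add_const ((1 / 4 : ℝ) • y)
    simpa using (hasDerivAt_const θ e).inner ℝ (hy.hasFDerivAt.comp_hasDerivAt θ h1)

theorem lipInBall_fderiv_bumpRho {n : ℕ} (x : En n) :
    LipInBall (fun y : En n => fderiv ℝ bumpRho y x) :=
  lipInBall_of_contDiff (bumpRho_fderiv_contDiff.clm_apply contDiff_const) fun y hy => by
    simp [bumpRho_fderiv_zero_off hy]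

theorem integrable_fderiv_bumpRho_mul {n : ℕ} {K : NNReal} {v : En n → En n}
    (hv : LipschitzWith K v) (h0 : v 0 = 0) (z x e : En n) : Integrable fun y : En n =>
      fderiv ℝ bumpRho y x * inner ℝ e (v (z + (1 / 4 : ℝ) • y)) :=
  (lipInBall_fderiv_bumpRho x).integrable_mul
    (continuous_const.inner (continuous_affine hv z (1 / 4))).measurable _
    fun _ hy => norm_inner_le_of_le le_rfl (norm_affine_le hv h0 z (1 / 4) hy)

theorem integral_rho_fderiv_affine {n : ℕ} {K : NNReal} {v : En n → En n}
    (hv : LipschitzWith K v) (h0 : v 0 = 0) (z x e : En n) :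
    ∫ y, bumpRho y * inner ℝ e (fderiv ℝ v (z + (1 / 4 : ℝ) • y) x) =
      -4 * ∫ y, fderiv ℝ bumpRho y x * inner ℝ e (v (z + (1 / 4 : ℝ) • y)) := by
  have h := integral_bump_fderiv (lipschitz_affine hv z (1 / 4)) x e
  have i1 : Integrable fun y : En n =>
      bumpRho y * inner ℝ e (fderiv ℝ v (z + (1 / 4 : ℝ) • y) x) := by
    refine bumpRho_lip.integrable_mul
      (measurable_const.inner (isBoundedBilinearMap_apply.continuous.measurable.comp
      (((measurable_fderiv ℝ v).comp
        (by fun_prop : Measurable fun y : En n => z + (1 / 4 : ℝ) • y)).prodMk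
        measurable_const))) (‖e‖ * (K * ‖x‖)) fun y _ => norm_inner_le_of_le le_rfl ?_
    exact (ContinuousLinearMap.le_opNorm _ _).trans
      (mul_le_mul_of_nonneg_right (norm_fderiv_le_of_lipschitz ℝ hv) (norm_nonneg _))
  have i2 := integrable_fderiv_bumpRho_mul hv h0 z x e
  have e1 : ∀ y, bumpRho y * inner ℝ (fderiv ℝ (fun y => v (z + (1 / 4 : ℝ) • y)) y x) e +
      fderiv ℝ bumpRho y x * inner ℝ (v (z + (1 / 4 : ℝ) • y)) e =
      1 / 4 * (bumpRho y * inner ℝ e (fderiv ℝ v (z + (1 / 4 : ℝ) • y) x)) +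
      fderiv ℝ bumpRho y x * inner ℝ e (v (z + (1 / 4 : ℝ) • y)) := fun y => by
    rw [fderiv_affine, _root_.smul_apply, real_inner_smul_left, real_inner_comm e, real_inner_comm e]
    ring
  simp only [e1] at h
  rw [integral_add (i1.const_mul _) i2, integral_const_mul] at h
  linarith

theorem integrable_norm_fderiv_bumpRho {n : ℕ} :
    Integrable fun y : En n => ‖fderiv ℝ bumpRho y‖ := by
  have h : LipInBall (fun y : En n => fderiv ℝ bumpRho y) :=
    lipInBall_of_contDiff bumpRho_fderiv_contDiff fun y hy => bumpRho_fderiv_zero_off hy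
  exact (bumpRho_fderiv_contDiff.continuous.integrable_of_hasCompactSupport
    h.hasCompactSupport).norm

/-- Second order expansion of the mollification at the origin. -/
theorem norm_mollify_sub_meanDeriv_le {n : ℕ} {K : NNReal} {v : En n → En n}
    (hv : LipschitzWith K v) (h0 : v 0 = 0) (x : En n) :
    ‖mollify v (1 / 4) x - mollify v (1 / 4) 0 - meanDeriv v x‖ ≤
      4 * (∫ y : En n, ‖fderiv ℝ bumpRho y‖) * K * ‖x‖ ^ 2 := by
  have hM : 0 ≤ ∫ y : En n, ‖fderiv ℝ bumpRho y‖ := integral_nonneg fun y => norm_nonneg _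
  refine norm_le_of_abs_inner_le (by positivity) fun e => ?_
  have := (convex_Icc (0 : ℝ) 1).norm_image_sub_le_of_norm_hasDerivWithin_le
    (f := fun θ : ℝ => (inner ℝ e (mollify v (1 / 4) (θ • x)) : ℝ) - θ * inner ℝ e (meanDeriv v x))
    (C := ‖e‖ * (4 * (∫ y : En n, ‖fderiv ℝ bumpRho y‖) * K * ‖x‖ ^ 2))
    (fun θ _ => ((hasDerivAt_mollify_translate hv h0 x e θ).sub
      ((hasDerivAt_id θ).mul_const _)).hasDerivWithinAt) (fun θ hθ => ?_)
    (Set.left_mem_Icc.2 zero_le_one) (Set.right_mem_Icc.2 zero_le_one)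
  · simp only [one_smul, zero_smul, one_mul, zero_mul, sub_zero, norm_one, mul_one] at this
    rw [inner_sub_right, inner_sub_right, ← Real.norm_eq_abs, sub_right_comm]
    exact this
  · rw [one_mul, meanDeriv_apply hv, integral_rho_fderiv_affine hv h0,
      integral_rho_fderiv_affine hv h0, ← mul_sub,
      ← integral_sub (integrable_fderiv_bumpRho_mul hv h0 _ x e)
        (integrable_fderiv_bumpRho_mul hv h0 _ x e), norm_mul]
    have h4 : ‖(-4 : ℝ)‖ = 4 := by norm_num
    rw [h4]
    have key : ‖∫ y, (fderiv ℝ bumpRho y x * inner ℝ e (v (θ • x + (1 / 4 : ℝ) • y)) -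
        fderiv ℝ bumpRho y x * inner ℝ e (v ((0 : En n) + (1 / 4 : ℝ) • y)))‖ ≤
        ∫ y : En n, (‖e‖ * K * ‖x‖ ^ 2) * ‖fderiv ℝ bumpRho y‖ := by
      refine norm_integral_le_of_norm_le (integrable_norm_fderiv_bumpRho.const_mul _)
        (Eventually.of_forall fun y => ?_)
      rw [← mul_sub, ← inner_sub_right, norm_mul]
      have h1 := (fderiv ℝ bumpRho y).le_opNorm x
      have h2 : ‖v (θ • x + (1 / 4 : ℝ) • y) - v ((0 : En n) + (1 / 4 : ℝ) • y)‖ ≤ K * ‖x‖ := by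
        refine (hv.norm_sub_le _ _).trans (mul_le_mul_of_nonneg_left ?_ K.2)
        rw [add_sub_add_right_eq_sub, sub_zero, norm_smul, Real.norm_of_nonneg hθ.1]
        exact mul_le_of_le_one_left (norm_nonneg _) hθ.2
      calc _ ≤ (‖fderiv ℝ bumpRho y‖ * ‖x‖) * (‖e‖ * (K * ‖x‖)) :=
            mul_le_mul h1 (norm_inner_le_of_le le_rfl h2) (norm_nonneg _) (by positivity)
        _ = _ := by ring
    rw [integral_const_mul] at key
    linarith

theorem exists_norm_sub_meanDeriv_le (n : ℕ) (K : NNReal) : ∃ C : ℝ, 0 ≤ C ∧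
    ∀ v : En n → En n, FreeBdryField K v → ∀ z : En n, ‖z‖ ≤ 1 / 4 → ∀ s, 0 < s → s ≤ 1 / 4 →
    ‖rhoMass n • v z - meanDeriv v z‖ ≤
      2 * (K * s * rhoMass n + C * ((s ^ n)⁻¹ * zeroMass v)) + C * ‖z‖ ^ 2 := by
  obtain ⟨C, hC, hC'⟩ := exists_norm_mollify_sub_le n
  have hM : 0 ≤ ∫ y : En n, ‖fderiv ℝ bumpRho y‖ := integral_nonneg fun y => norm_nonneg _
  refine ⟨max C (4 * (∫ y : En n, ‖fderiv ℝ bumpRho y‖) * K), hC.trans (le_max_left _ _),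
    fun v hv z hz s hs hs' => ?_⟩
  have hmass : 0 ≤ (s ^ n)⁻¹ * zeroMass v := mul_nonneg (by positivity) (zeroMass_nonneg _)
  have h1 := hC' K v hv z hz s hs hs'
  have h2 := hC' K v hv 0 (by simp) s hs hs'
  have h3 := norm_mollify_sub_le hv.1 hv.2.1 hs.le z
  have h4 := norm_mollify_sub_le hv.1 hv.2.1 hs.le 0
  have h5 := norm_mollify_sub_meanDeriv_le hv.1 hv.2.1 z
  have h6 := mul_le_mul_of_nonneg_right
    (le_max_left C (4 * (∫ y : En n, ‖fderiv ℝ bumpRho y‖) * K)) hmass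
  have h7 := mul_le_mul_of_nonneg_right
    (le_max_right C (4 * (∫ y : En n, ‖fderiv ℝ bumpRho y‖) * K)) (sq_nonneg ‖z‖)
  have e : rhoMass n • v z - meanDeriv v z =
      (mollify v (1 / 4) z - mollify v (1 / 4) 0 - meanDeriv v z) -
      (mollify v (1 / 4) z - mollify v s z) - (mollify v s z - rhoMass n • v z) +
      ((mollify v (1 / 4) 0 - mollify v s 0) + (mollify v s 0 - rhoMass n • v 0)) := by
    rw [hv.2.1, smul_zero]; abel
  rw [e]
  refine (norm_add_le _ _).trans ?_
  have a1 := norm_sub_le ((mollify v (1 / 4) z - mollify v (1 / 4) 0 - meanDeriv v z) -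
      (mollify v (1 / 4) z - mollify v s z)) (mollify v s z - rhoMass n • v z)
  have a2 := norm_sub_le (mollify v (1 / 4) z - mollify v (1 / 4) 0 - meanDeriv v z)
      (mollify v (1 / 4) z - mollify v s z)
  have a3 := norm_add_le (mollify v (1 / 4) 0 - mollify v s 0) (mollify v s 0 - rhoMass n • v 0)
  linarith

/-- If the mass of the zero set vanishes in the limit, the flow becomes close to symmetric linear
fields of unit trace. -/
theorem eventually_near_linear {n : ℕ} (hn : 0 < n) {K : NNReal} {w : En n → En n}
    (hw : FreeBdryField K w) (hz : Tendsto (fun t => zeroMass (flow w t)) atTop (𝓝 0))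
    {ε : ℝ} (hε : 0 < ε) : ∀ᶠ t in atTop, ∃ A : En n →L[ℝ] En n,
      (∀ a b, inner ℝ (A a) b = inner ℝ a (A b)) ∧
      |LinearMap.trace ℝ (En n) (A : En n →ₗ[ℝ] En n) - 1| ≤ ε ∧
      ∀ x, ‖x‖ ≤ 1 → ‖flow w t x - A x‖ ≤ ε := by
  obtain ⟨C, hC, hC'⟩ := exists_norm_sub_meanDeriv_le n K
  obtain ⟨D, hD, hD'⟩ := exists_abs_trace_meanDeriv_sub_le n
  have hm := rhoMass_pos hn
  set m := rhoMass n with hm_def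
  set θ : ℝ := min (1 / 4) (ε * m / (2 * (C + 1))) with hθ
  have hθ0 : 0 < θ := lt_min (by norm_num) (by positivity)
  have hθ4 : θ ≤ 1 / 4 := min_le_left _ _
  have hθε : C * θ ≤ ε * m / 2 := by
    have : θ ≤ ε * m / (2 * (C + 1)) := min_le_right _ _
    rw [le_div_iff₀ (by positivity)] at this
    linarith
  set s : ℝ := min (1 / 4) (ε * θ / (8 * (K + 1))) with hs
  have hs0 : 0 < s := lt_min (by norm_num) (by positivity)
  have hs4 : s ≤ 1 / 4 := min_le_left _ _
  have hsε : K * s ≤ ε * θ / 8 := by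
    have : s ≤ ε * θ / (8 * (K + 1)) := min_le_right _ _
    rw [le_div_iff₀ (by positivity)] at this
    linarith
  have hlim : Tendsto (fun t => zeroMass (flow w (t - -Real.log θ))) atTop (𝓝 0) :=
    hz.comp (tendsto_atTop_add_const_right _ _ tendsto_id)
  have l1 : ∀ᶠ t in atTop, C * ((s ^ n)⁻¹ * zeroMass (flow w (t - -Real.log θ))) < ε * θ * m / 8 :=
    Tendsto.eventually_lt_const (v := 0) (by positivity)
      (by simpa using (hlim.const_mul ((s ^ n)⁻¹)).const_mul C)
  have l2 : ∀ᶠ t in atTop, D * zeroMass (flow w (t - -Real.log θ)) < ε * m :=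
    Tendsto.eventually_lt_const (v := 0) (by positivity) (by simpa using hlim.const_mul D)
  filter_upwards [l1, l2, eventually_ge_atTop (-Real.log θ)] with t h1 h2 ht
  set v := flow w (t - -Real.log θ) with hv_def
  have hv : FreeBdryField K v := hw.flow (by linarith)
  refine ⟨m⁻¹ • meanDeriv v, fun a b => ?_, ?_, fun x hx => ?_⟩
  · simp only [_root_.smul_apply, real_inner_smul_left, real_inner_smul_right, meanDeriv_symm hv]
  · have h3 := hD' K v hv
    have e : LinearMap.trace ℝ (En n) ((m⁻¹ • meanDeriv v : En n →L[ℝ] En n) : En n →ₗ[ℝ] En n) - 1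
        = m⁻¹ * (LinearMap.trace ℝ (En n) (meanDeriv v : En n →ₗ[ℝ] En n) - m) := by
      rw [ContinuousLinearMap.toLinearMap_smul, map_smul, smul_eq_mul]
      field_simp
    rw [e, abs_mul, abs_of_pos (inv_pos.2 hm), inv_mul_le_iff₀ hm]
    linarith
  · have e : flow w t x = θ⁻¹ • v (θ • x) := by
      have : flow w t = flow v (-Real.log θ) := by rw [hv_def, flow_flow]; simp
      rw [this]
      simp only [flow, neg_neg, Real.exp_neg, Real.exp_log hθ0]
    have e2 : θ⁻¹ • v (θ • x) - (m⁻¹ • meanDeriv v) x =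
        (θ⁻¹ * m⁻¹) • (m • v (θ • x) - meanDeriv v (θ • x)) := by
      rw [map_smul, _root_.smul_apply, smul_sub, smul_smul, smul_smul, mul_assoc,
        inv_mul_cancel₀ hm.ne', mul_one, mul_right_comm, inv_mul_cancel₀ hθ0.ne', one_mul]
    have hn1 : ‖θ • x‖ ≤ θ := by
      rw [norm_smul, Real.norm_of_nonneg hθ0.le]
      exact mul_le_of_le_one_right hθ0.le hx
    have h3 := hC' v hv (θ • x) (hn1.trans hθ4) s hs0 hs4
    have h4 : C * ‖θ • x‖ ^ 2 ≤ C * θ ^ 2 := by gcongr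
    have h5 : C * θ ^ 2 ≤ ε * m / 2 * θ := by nlinarith
    have h6 : K * s * m ≤ ε * θ / 8 * m := by gcongr
    rw [e, e2, norm_smul, Real.norm_of_nonneg (by positivity), ← mul_inv, inv_mul_le_iff₀ (by positivity)]
    nlinarith

/-- The point of Euclidean space whose `i`-th coordinate is `a` and whose others are given
by `y`. -/
def insertVec {m : ℕ} (i : Fin (m + 1)) (a : ℝ) (y : Fin m → ℝ) : En (m + 1) :=
  WithLp.toLp 2 (i.insertNth a y)

theorem insertVec_self {m : ℕ} (i : Fin (m + 1)) (x : En (m + 1)) :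
    insertVec i (x i) (fun j => x (i.succAbove j)) = x :=
  congrArg (WithLp.toLp 2) (Fin.insertNth_self_removeNth i x.ofLp)

theorem norm_sq_insertVec {m : ℕ} (i : Fin (m + 1)) (a : ℝ) (y : Fin m → ℝ) :
    ‖insertVec i a y‖ ^ 2 = a ^ 2 + ∑ j, y j ^ 2 := by
  rw [EuclideanSpace.norm_sq_eq, Fin.sum_univ_succAbove _ i]
  simp [insertVec]

theorem smul_insertVec {m : ℕ} (i : Fin (m + 1)) (c a : ℝ) (y : Fin m → ℝ) :
    c • insertVec i a y = insertVec i (c * a) (c • y) := by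
  ext k
  refine Fin.succAboveCases i ?_ (fun j => ?_) k <;> simp [insertVec]

theorem contDiff_insertVec {m : ℕ} (i : Fin (m + 1)) (a : ℝ) :
    ContDiff ℝ 1 (insertVec i a) := by
  refine (contDiff_piLp 2).2 fun k => ?_
  refine Fin.succAboveCases i ?_ (fun j => ?_) k
  · simpa [insertVec] using contDiff_const
  · simpa [insertVec] using contDiff_apply ℝ ℝ j

/-- Central projection of a face of the cube to the unit sphere. -/
def faceChart {m : ℕ} (i : Fin (m + 1)) (a : ℝ) (y : Fin m → ℝ) : En (m + 1) :=
  ‖insertVec i a y‖⁻¹ • insertVec i a y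

theorem hausdorffMeasure_faceChart_lt_top {m : ℕ} (i : Fin (m + 1)) {a : ℝ} (ha : a ≠ 0) :
    Measure.hausdorffMeasure (m : ℝ) (faceChart i a '' closedBall (0 : Fin m → ℝ) 1) < ⊤ := by
  have h0 : ∀ y, insertVec i a y ≠ 0 := fun y h => by
    have := norm_sq_insertVec i a y
    rw [h, norm_zero, zero_pow two_ne_zero] at this
    have h2 : 0 ≤ ∑ j, y j ^ 2 := Finset.sum_nonneg fun j _ => sq_nonneg _
    have h3 : 0 < a ^ 2 := by positivity
    linarith
  have hc : ContDiff ℝ 1 (faceChart i a) :=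
    (((contDiff_insertVec i a).norm ℝ h0).inv fun y => (norm_ne_zero_iff.2 (h0 y))).smul
      (contDiff_insertVec i a)
  obtain ⟨L, hL⟩ := hc.locallyLipschitz.locallyLipschitzOn.exists_lipschitzOnWith_of_compact
    (isCompact_closedBall (0 : Fin m → ℝ) 1)
  refine (hL.hausdorffMeasure_image_le (Nat.cast_nonneg m)).trans_lt
    (ENNReal.mul_lt_top (ENNReal.rpow_lt_top_of_nonneg (Nat.cast_nonneg m) ENNReal.coe_ne_top) ?_)
  have h := hausdorffMeasure_pi_real (ι := Fin m)
  rw [Fintype.card_fin] at h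
  rw [h]
  exact measure_closedBall_lt_top

theorem isFiniteMeasure_sphMeas {n : ℕ} (hn : 0 < n) : IsFiniteMeasure (sphMeas n) := by
  obtain ⟨m, rfl⟩ := Nat.exists_eq_succ_of_ne_zero hn.ne'
  refine ⟨?_⟩
  rw [sphMeas, Measure.restrict_apply_univ]
  have hm : ((Nat.succ m : ℕ) : ℝ) - 1 = m := by push_cast; ring
  rw [hm]
  have hcov : sphere (0 : En (m + 1)) 1 ⊆ ⋃ i : Fin (m + 1),
      (faceChart i 1 '' closedBall (0 : Fin m → ℝ) 1 ∪
        faceChart i (-1) '' closedBall (0 : Fin m → ℝ) 1) := by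
    intro x hx
    have hx1 : ‖x‖ = 1 := by simpa using hx
    obtain ⟨i, hi⟩ := Finite.exists_max fun i => |x i|
    have hxi : 0 < |x i| := by
      refine (abs_nonneg _).lt_of_ne' fun h => ?_
      have : x = 0 := by
        ext k
        exact abs_eq_zero.1 (le_antisymm ((hi k).trans h.le) (abs_nonneg _))
      simp [this] at hx1
    set y : Fin m → ℝ := |x i|⁻¹ • fun j => x (i.succAbove j) with hy
    have hyb : y ∈ closedBall (0 : Fin m → ℝ) 1 := by
      rw [mem_closedBall_zero_iff]
      refine (pi_norm_le_iff_of_nonneg zero_le_one).2 fun j => ?_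
      simp only [hy, Pi.smul_apply, smul_eq_mul, norm_mul, norm_inv, Real.norm_eq_abs, abs_abs]
      rw [inv_mul_le_iff₀ hxi, mul_one]
      exact hi _
    have hz : insertVec i (|x i|⁻¹ * x i) y = |x i|⁻¹ • x := by
      rw [hy, ← smul_insertVec, insertVec_self]
    have hch : faceChart i (|x i|⁻¹ * x i) y = x := by
      rw [faceChart, hz, norm_smul, hx1, mul_one, norm_inv, Real.norm_eq_abs, abs_abs, smul_smul,
        inv_inv, mul_inv_cancel₀ hxi.ne', one_smul]
    refine Set.mem_iUnion.2 ⟨i, ?_⟩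
    rcases abs_choice (x i) with h | h
    · left
      refine ⟨y, hyb, ?_⟩
      rwa [h, inv_mul_cancel₀ (h ▸ hxi.ne')] at hch
    · right
      refine ⟨y, hyb, ?_⟩
      have hne : x i ≠ 0 := abs_pos.1 hxi
      have : |x i|⁻¹ * x i = -1 := by rw [h]; field_simp
      rwa [this] at hch
  refine (measure_mono hcov).trans_lt ?_
  refine (measure_iUnion_le _).trans_lt ?_
  rw [tsum_fintype, ENNReal.sum_lt_top]
  intro i _
  exact measure_union_lt_top (hausdorffMeasure_faceChart_lt_top i one_ne_zero)
    (hausdorffMeasure_faceChart_lt_top i (by norm_num))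

/-- Nonempty relatively open subsets of the sphere have positive surface measure. -/
theorem sphMeas_pos_of_isOpen {n : ℕ} {U : Set (En n)} (hU : IsOpen U) {x : En n} (hx : x ∈ U)
    (hx1 : ‖x‖ = 1) : 0 < sphMeas n U := by
  obtain ⟨i, hi⟩ : ∃ i, x i ≠ 0 := by
    by_contra! h
    have : x = 0 := by ext k; exact h k
    simp [this] at hx1
  obtain ⟨m, rfl⟩ : ∃ m, n = m + 1 := Nat.exists_eq_succ_of_ne_zero (by rintro rfl; exact i.elim0)
  rw [sphMeas, Measure.restrict_apply hU.measurableSet]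
  have hm : ((m + 1 : ℕ) : ℝ) - 1 = m := by push_cast; ring
  rw [hm]
  set P : En (m + 1) → (Fin m → ℝ) := fun z j => z (i.succAbove j) with hP
  have hPl : LipschitzWith 1 P := by
    refine LipschitzWith.of_dist_le_mul fun a b => ?_
    rw [NNReal.coe_one, one_mul]
    refine (dist_pi_le_iff dist_nonneg).2 fun j => ?_
    exact PiLp.dist_apply_le (p := 2) a b _
  set σ : ℝ := x i / |x i| with hσ
  have hσ2 : σ ^ 2 = 1 := by
    rw [hσ, div_pow, sq_abs]; exact div_self (pow_ne_zero 2 hi)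
  set Z : (Fin m → ℝ) → En (m + 1) := fun y => insertVec i (σ * √(1 - ∑ j, y j ^ 2)) y with hZ
  have hZc : Continuous Z := by
    refine (PiLp.continuous_toLp 2 _).comp ?_
    exact Continuous.finInsertNth i (by fun_prop) continuous_id
  have hs : x i ^ 2 + ∑ j, P x j ^ 2 = 1 := by
    have := norm_sq_insertVec i (x i) (P x)
    rw [hP, insertVec_self, hx1] at this
    rw [hP]; linarith
  have hZx : Z (P x) = x := by
    have h1 : 1 - ∑ j, P x j ^ 2 = x i ^ 2 := by linarith
    have h2 : σ * |x i| = x i := div_mul_cancel₀ _ (abs_pos.2 hi).ne'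
    simp only [hZ, h1, Real.sqrt_sq_eq_abs, h2]
    exact insertVec_self i x
  set V : Set (Fin m → ℝ) := {y | ∑ j, y j ^ 2 < 1} ∩ Z ⁻¹' U with hV
  have hVo : IsOpen V :=
    (isOpen_lt (by fun_prop) continuous_const).inter (hU.preimage hZc)
  have hVx : P x ∈ V := by
    refine ⟨?_, ?_⟩
    · have : 0 < x i ^ 2 := by positivity
      change ∑ j, P x j ^ 2 < 1
      linarith
    · change Z (P x) ∈ U
      rw [hZx]; exact hx
  have hVP : V ⊆ P '' (U ∩ sphere 0 1) := by
    rintro y ⟨hy1, hy2⟩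
    refine ⟨Z y, ⟨hy2, ?_⟩, ?_⟩
    · have h1 : ‖Z y‖ ^ 2 = 1 := by
        rw [hZ, norm_sq_insertVec, mul_pow, hσ2, Real.sq_sqrt (sub_nonneg.2 (le_of_lt hy1))]
        ring
      rw [mem_sphere_zero_iff_norm]
      nlinarith [norm_nonneg (Z y)]
    · ext j
      simp [hP, hZ, insertVec]
  have hpos : 0 < Measure.hausdorffMeasure (m : ℝ) V := by
    have h := hausdorffMeasure_pi_real (ι := Fin m)
    rw [Fintype.card_fin] at h
    rw [h]
    exact hVo.measure_pos _ ⟨_, hVx⟩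
  have := (measure_mono hVP).trans
    (hPl.hausdorffMeasure_image_le (Nat.cast_nonneg m) (U ∩ sphere 0 1))
  rw [ENNReal.coe_one, ENNReal.one_rpow, one_mul] at this
  exact hpos.trans_le this

theorem ae_sphMeas {n : ℕ} : ∀ᵐ x ∂sphMeas n, ‖x‖ = 1 := by
  filter_upwards [ae_restrict_mem (μ := Measure.hausdorffMeasure ((n : ℝ) - 1))
    (isClosed_sphere (x := (0 : En n)) (ε := 1)).measurableSet] with x hx
  simpa using hx

theorem norm_inner_clm_le {n : ℕ} (A : En n →L[ℝ] En n) {x : En n} (hx : ‖x‖ = 1) :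
    ‖(inner ℝ x (A x) : ℝ)‖ ≤ ‖A‖ := by
  refine (norm_inner_le_norm _ _).trans ?_
  simpa [hx] using A.le_opNorm x

theorem exists_coercive {n : ℕ} (hn : 0 < n) : ∃ c : ℝ, 0 < c ∧ ∀ A : En n →L[ℝ] En n,
    (∀ a b, inner ℝ (A a) b = inner ℝ a (A b)) →
    c * ‖A‖ ^ 2 ≤ ∫ x, (inner ℝ x (A x) : ℝ) ^ 2 ∂sphMeas n := by
  have := isFiniteMeasure_sphMeas hn
  have : ProperSpace (En n →L[ℝ] En n) := FiniteDimensional.proper ℝ _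
  set S : Set (En n →L[ℝ] En n) :=
    {A | ∀ a b, inner ℝ (A a) b = inner ℝ a (A b)} ∩ sphere 0 1 with hS
  have hSc : IsCompact S := by
    refine (isCompact_sphere 0 1).inter_left ?_
    simp only [Set.ofPred_forall]
    refine isClosed_iInter fun a => isClosed_iInter fun b => isClosed_eq ?_ ?_
    · exact ((ContinuousLinearMap.apply ℝ (En n) a).continuous).inner continuous_const
    · exact continuous_const.inner ((ContinuousLinearMap.apply ℝ (En n) b).continuous)
  set F : (En n →L[ℝ] En n) → ℝ := fun A => ∫ x, (inner ℝ x (A x) : ℝ) ^ 2 ∂sphMeas n with hF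
  have hcont : ∀ A : En n →L[ℝ] En n, Continuous fun x : En n => (inner ℝ x (A x) : ℝ) ^ 2 :=
    fun A => (continuous_id.inner A.continuous).pow 2
  have hb : ∀ A : En n →L[ℝ] En n, ∀ᵐ x ∂sphMeas n, ‖(inner ℝ x (A x) : ℝ) ^ 2‖ ≤ ‖A‖ ^ 2 := by
    intro A
    filter_upwards [ae_sphMeas] with x hx
    rw [norm_pow]
    exact pow_le_pow_left₀ (norm_nonneg _) (norm_inner_clm_le A hx) 2
  have hFc : ContinuousOn F S := by
    refine continuousOn_of_dominated (bound := fun _ => 1)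
      (fun A _ => (hcont A).aestronglyMeasurable) (fun A hA => ?_) (integrable_const _)
      (Eventually.of_forall fun x => Continuous.continuousOn ?_)
    · filter_upwards [hb A] with x hx
      refine hx.trans ?_
      have : ‖A‖ = 1 := by simpa using hA.2
      rw [this]; norm_num
    · exact (continuous_const.inner (ContinuousLinearMap.apply ℝ (En n) x).continuous).pow 2
  have hpos : ∀ A ∈ S, 0 < F A := by
    intro A hA
    rw [hF, integral_pos_iff_support_of_nonneg (fun x => sq_nonneg _)
      (Integrable.of_bound (hcont A).aestronglyMeasurable _ (hb A))]
    have hne : ∃ x, (inner ℝ x (A x) : ℝ) ≠ 0 := by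
      by_contra! h
      have h1 : (A : En n →ₗ[ℝ] En n) = 0 :=
        (LinearMap.IsSymmetric.inner_map_self_eq_zero (T := (A : En n →ₗ[ℝ] En n)) hA.1).1
          fun x => by rw [real_inner_comm]; exact h x
      have h2 : A = 0 := ContinuousLinearMap.coe_injective h1
      have h3 := hA.2
      simp [h2] at h3
    obtain ⟨x, hx⟩ := hne
    have hx0 : x ≠ 0 := by rintro rfl; simp at hx
    refine sphMeas_pos_of_isOpen (x := ‖x‖⁻¹ • x) ?_ ?_ ?_
    · exact (isOpen_compl_singleton (x := (0 : ℝ))).preimage (hcont A)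
    · rw [Function.mem_support, map_smul, real_inner_smul_left, real_inner_smul_right]
      have := norm_ne_zero_iff.2 hx0
      positivity
    · rw [norm_smul, norm_inv, norm_norm, inv_mul_cancel₀ (norm_ne_zero_iff.2 hx0)]
  have hscale : ∀ A : En n →L[ℝ] En n, A ≠ 0 → F A = ‖A‖ ^ 2 * F (‖A‖⁻¹ • A) := by
    intro A hA
    have := norm_ne_zero_iff.2 hA
    rw [hF]
    simp only [_root_.smul_apply, real_inner_smul_right, mul_pow]
    rw [integral_const_mul]
    field_simp
  have hmemS : ∀ A : En n →L[ℝ] En n, A ≠ 0 → (∀ a b, inner ℝ (A a) b = inner ℝ a (A b)) →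
      ‖A‖⁻¹ • A ∈ S := by
    intro A hA h
    refine ⟨fun a b => ?_, ?_⟩
    · simp only [_root_.smul_apply, real_inner_smul_left, real_inner_smul_right, h]
    · rw [mem_sphere_zero_iff_norm, norm_smul, norm_inv, norm_norm,
        inv_mul_cancel₀ (norm_ne_zero_iff.2 hA)]
  rcases S.eq_empty_or_nonempty with hE | hE
  · refine ⟨1, one_pos, fun A hA => ?_⟩
    by_cases h0 : A = 0
    · simp [h0]
    · have := hmemS A h0 hA
      simp [hE] at this
  · obtain ⟨A₀, hA₀, hmin⟩ := hSc.exists_isMinOn hE hFc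
    refine ⟨F A₀, hpos A₀ hA₀, fun A hA => ?_⟩
    by_cases h0 : A = 0
    · simp [h0]
    · change F A₀ * ‖A‖ ^ 2 ≤ F A
      rw [hscale A h0, mul_comm]
      exact mul_le_mul_of_nonneg_left (hmin (hmemS A h0 hA)) (sq_nonneg _)

/-- The operator of a matrix. -/
def matOp {n : ℕ} (B : Matrix (Fin n) (Fin n) ℝ) : En n →L[ℝ] En n :=
  Matrix.toEuclideanCLM (𝕜 := ℝ) B

theorem matOp_sub {n : ℕ} (B C : Matrix (Fin n) (Fin n) ℝ) : matOp (B - C) = matOp B - matOp C :=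
  map_sub _ _ _

theorem psiM_eq {n : ℕ} (B : Matrix (Fin n) (Fin n) ℝ) (x : En n) :
    psiM B x = 1 / 2 * inner ℝ x (matOp B x) := by
  rw [psiM, PiLp.inner_apply]
  congr 1
  refine Finset.sum_congr rfl fun i _ => ?_
  rw [matOp, Matrix.ofLp_toEuclideanCLM]
  simp only [Matrix.mulVec, dotProduct, RCLike.inner_apply, conj_trivial, Finset.sum_mul]
  exact Finset.sum_congr rfl fun j _ => by ring

theorem matOp_symm {n : ℕ} {B : Matrix (Fin n) (Fin n) ℝ} (hB : B.IsSymm) (a b : En n) :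
    inner ℝ (matOp B a) b = inner ℝ a (matOp B b) := by
  have h : star (matOp B) = matOp B := by
    rw [matOp, ← map_star]
    exact congrArg _ hB
  rw [ContinuousLinearMap.star_eq_adjoint] at h
  rw [← ContinuousLinearMap.adjoint_inner_right, h]

theorem trace_matOp {n : ℕ} (B : Matrix (Fin n) (Fin n) ℝ) :
    LinearMap.trace ℝ (En n) (matOp B : En n →ₗ[ℝ] En n) = B.trace := by
  rw [LinearMap.trace_eq_sum_inner _ (EuclideanSpace.basisFun (Fin n) ℝ)]
  refine Finset.sum_congr rfl fun i _ => ?_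
  simp [matOp, Matrix.ofLp_toEuclideanCLM, EuclideanSpace.inner_single_left]

/-- A symmetric operator has a symmetric trace free matrix part. -/
theorem exists_matOp_eq {n : ℕ} (hn : 0 < n) {A : En n →L[ℝ] En n}
    (hA : ∀ a b, inner ℝ (A a) b = inner ℝ a (A b)) : ∃ B : Matrix (Fin n) (Fin n) ℝ, S0 B ∧
      ∀ x, matOp B x = A x - (LinearMap.trace ℝ (En n) (A : En n →ₗ[ℝ] En n) / n) • x := by
  set M := (Matrix.toEuclideanCLM (𝕜 := ℝ) (n := Fin n)).symm A with hM
  have hMA : matOp M = A := by simp [hM, matOp]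
  have hMs : M.IsSymm := by
    have h1 : star A = A := by
      rw [ContinuousLinearMap.star_eq_adjoint]
      exact ((ContinuousLinearMap.eq_adjoint_iff A A).2 hA).symm
    have h2 : star M = M := by
      refine (Matrix.toEuclideanCLM (𝕜 := ℝ) (n := Fin n)).injective ?_
      exact (map_star (Matrix.toEuclideanCLM (𝕜 := ℝ) (n := Fin n)) M).trans
        ((congrArg star hMA).trans (h1.trans hMA.symm))
    rwa [Matrix.star_eq_conjTranspose, Matrix.conjTranspose_eq_transpose_of_trivial] at h2
  refine ⟨M - (M.trace / n) • (1 : Matrix (Fin n) (Fin n) ℝ), ⟨?_, ?_⟩, fun x => ?_⟩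
  · exact hMs.sub (Matrix.isSymm_one.smul _)
  · rw [Matrix.trace_sub, Matrix.trace_smul, Matrix.trace_one, Fintype.card_fin, smul_eq_mul]
    have : (n : ℝ) ≠ 0 := by positivity
    field_simp
    ring
  · rw [matOp_sub, hMA, ← trace_matOp, hMA]
    simp [matOp]

theorem hasGradientAt_qB {n : ℕ} {B : Matrix (Fin n) (Fin n) ℝ} (hB : B.IsSymm) (x : En n) :
    HasGradientAt (qB B) ((n : ℝ)⁻¹ • x + matOp B x) x := by
  rw [hasGradientAt_iff_hasFDerivAt]
  have e : qB B = fun x : En n => (2 * n : ℝ)⁻¹ * inner ℝ x x + 1 / 2 * inner ℝ x (matOp B x) := by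
    ext y
    rw [qB, p0, psiM_eq, real_inner_self_eq_norm_sq]
    ring
  rw [e]
  have h1 := ((hasFDerivAt_id x).inner ℝ (hasFDerivAt_id x)).const_mul (2 * n : ℝ)⁻¹
  have h2 := ((hasFDerivAt_id x).inner ℝ (matOp B).hasFDerivAt).const_mul (1 / 2 : ℝ)
  refine (h1.add h2).congr_fderiv ?_
  ext y
  simp only [_root_.add_apply, _root_.smul_apply, ContinuousLinearMap.comp_apply,
    ContinuousLinearMap.prod_apply, fderivInnerCLM_apply, InnerProductSpace.toDual_apply_apply,
    smul_eq_mul, id, ContinuousLinearMap.id_apply, inner_add_left, real_inner_smul_left]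
  rw [real_inner_comm x y, matOp_symm hB, real_inner_comm (matOp B x) y, ← matOp_symm hB x y]
  have : (n : ℝ)⁻¹ = 2 * (2 * n : ℝ)⁻¹ := by rw [mul_inv]; ring
  rw [this]
  ring

theorem ae_fderiv_eq_zero_of_zeros {n : ℕ} {K : NNReal} {w : En n → En n}
    (hw : LipschitzWith K w) : ∀ᵐ x, w x = 0 → fderiv ℝ w x = 0 := by
  set s : Set (En n) := {x | w x = 0} ∩ {x | DifferentiableAt ℝ w x} with hs
  have hsm : MeasurableSet s :=
    (measurableSet_zeros hw).inter (measurableSet_of_differentiableAt ℝ w)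
  have happ : ApproximatesLinearOn w (0 : En n →L[ℝ] En n) s 0 := by
    intro x hx y hy
    have h1 : w x = 0 := hx.1
    have h2 : w y = 0 := hy.1
    simp [h1, h2]
  have h := happ.norm_fderiv_sub_le volume hsm (fderiv ℝ w)
    fun x hx => (DifferentiableAt.hasFDerivAt hx.2).hasFDerivWithinAt
  rw [ae_restrict_iff' hsm] at h
  filter_upwards [h, hw.ae_differentiableAt] with x hx hd h0
  have := hx ⟨h0, hd⟩
  simpa using this

theorem gradient_fderiv_symm {n : ℕ} {u : En n → ℝ} {x : En n} {D : En n →L[ℝ] En n}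
    (hu : ∀ᶠ y in 𝓝 x, DifferentiableAt ℝ u y) (hD : HasFDerivAt (fun y => gradient u y) D x)
    (a b : En n) : inner ℝ (D a) b = inner ℝ a (D b) := by
  let J : En n →L[ℝ] En n →L[ℝ] ℝ := innerSL ℝ
  have h := second_derivative_symmetric_of_eventually_of_real (f := u)
    (f' := fun y => J (gradient u y)) (f'' := J.comp D) (x := x)
    (hu.mono fun y hy => hy.hasGradientAt.hasFDerivAt) (J.hasFDerivAt.comp x hD) a b
  rw [real_inner_comm (D b) a]
  exact h

theorem SolutionHyp.exists_freeBdryField {n : ℕ} {u : En n → ℝ} (hu : SolutionHyp u) :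
    ∃ (K : NNReal) (w : En n → En n), FreeBdryField K w ∧ ∀ x, ‖x‖ < 1 → gradient u x = w x := by
  obtain ⟨hd, ⟨L, hL⟩, hae, -, h0⟩ := hu
  obtain ⟨w, hw, heq⟩ := hL.extend_finite_dimension
  have heq' : ∀ x, ‖x‖ < 1 → gradient u x = w x := fun x hx => heq (by simpa using hx)
  refine ⟨_, w, ⟨hw, ?_, ?_⟩, heq'⟩
  · rw [← heq' 0 (by simp), h0]
  · rw [ae_restrict_iff' isOpen_ball.measurableSet] at hae
    filter_upwards [hae, ae_fderiv_eq_zero_of_zeros hw] with x hx hz hx1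
    have hxb : x ∈ ball (0 : En n) 1 := by simpa using hx1
    obtain ⟨D, hD, -, hD1⟩ := hx hxb
    have hev : ∀ᶠ y in 𝓝 x, y ∈ ball (0 : En n) 1 := isOpen_ball.mem_nhds hxb
    have hwD : fderiv ℝ w x = D :=
      (hD.congr_of_eventuallyEq (hev.mono fun y hy => (heq hy).symm)).fderiv
    refine ⟨?_, fun hne => ?_, hz⟩
    · rw [hwD]
      exact gradient_fderiv_symm (hev.mono fun y hy => hd y hy) hD
    · rw [diverg, hwD]
      exact hD1 (by rwa [heq' x hx1])

theorem hasGradientAt_rescale {n : ℕ} {u : En n → ℝ} {c : ℝ} (hc : 0 < c) {x : En n}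
    (hd : DifferentiableAt ℝ u (c • x)) :
    HasGradientAt (fun y => (u (c • y) - u 0) / c ^ 2) (c⁻¹ • gradient u (c • x)) x := by
  rw [hasGradientAt_iff_hasFDerivAt]
  have h1 : HasFDerivAt (fun y : En n => c • y) (c • ContinuousLinearMap.id ℝ (En n)) x :=
    (hasFDerivAt_id x).const_smul c
  have h2 := ((hd.hasGradientAt.hasFDerivAt.comp x h1).sub_const (u 0)).mul_const ((c ^ 2)⁻¹)
  refine (h2.congr_fderiv ?_).congr_of_eventuallyEq (Eventually.of_forall fun y => ?_)
  · ext y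
    simp only [_root_.smul_apply, ContinuousLinearMap.comp_apply, smul_eq_mul,
      InnerProductSpace.toDual_apply_apply, ContinuousLinearMap.id_apply,
      real_inner_smul_left, real_inner_smul_right]
    field_simp
  · simp [div_eq_mul_inv]

theorem ut_eq {n : ℕ} (u : En n → ℝ) (t : ℝ) :
    ut u t = fun y => (u (Real.exp (-t) • y) - u 0) / Real.exp (-t) ^ 2 := by
  ext y
  rw [ut, ← Real.exp_nat_mul, div_eq_inv_mul, ← Real.exp_neg]
  congr 2
  push_cast; ring

theorem hasGradientAt_ut {n : ℕ} {u : En n → ℝ} {w : En n → En n} (hu : SolutionHyp u)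
    (hw : ∀ x, ‖x‖ < 1 → gradient u x = w x) {t : ℝ} (ht : 0 < t) {x : En n} (hx : ‖x‖ ≤ 1) :
    HasGradientAt (ut u t) (flow w t x) x := by
  have hlt : ‖Real.exp (-t) • x‖ < 1 := by
    rw [norm_smul, Real.norm_of_nonneg (Real.exp_pos _).le]
    have : Real.exp (-t) < 1 := Real.exp_lt_one_iff.2 (by linarith)
    nlinarith [norm_nonneg x, Real.exp_pos (-t)]
  have h := hasGradientAt_rescale (u := u) (Real.exp_pos (-t)) (x := x)
    (hu.1 _ (by simpa using hlt))
  rw [hw _ hlt, ← Real.exp_neg, neg_neg, ← ut_eq] at h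
  exact h

theorem tendsto_zeroMass_of_singular {n : ℕ} (hn : 0 < n) {u : En n → ℝ} {K : NNReal}
    {w : En n → En n} (hu : SolutionHyp u) (hs : IsSingular u) (hwF : FreeBdryField K w)
    (hw : ∀ x, ‖x‖ < 1 → gradient u x = w x) :
    Tendsto (fun t => zeroMass (flow w t)) atTop (𝓝 0) := by
  obtain ⟨r, B, hr0, hr, hB, hconv⟩ := hs
  have hn' : (n : ℝ) ≠ 0 := by positivity
  refine tendsto_zeroMass hwF (A := (n : ℝ)⁻¹ • ContinuousLinearMap.id ℝ (En n) + matOp B)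
    (τ := fun k => -Real.log (r k)) ?_ ?_ fun x hx => ?_
  · rw [ContinuousLinearMap.toLinearMap_add, map_add, trace_matOp, hB.2,
      ContinuousLinearMap.toLinearMap_smul, map_smul, add_zero, ContinuousLinearMap.coe_id,
      LinearMap.trace_id, finrank_euclideanSpace_fin, smul_eq_mul, inv_mul_cancel₀ hn']
  · refine tendsto_neg_atBot_atTop.comp (Real.tendsto_log_nhdsGT_zero.comp ?_)
    exact tendsto_nhdsWithin_iff.2 ⟨hr, Eventually.of_forall hr0⟩
  · have h := (hconv {x} isCompact_singleton).2.tendsto_at (Set.mem_singleton x)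
    rw [(hasGradientAt_qB hB.1 x).gradient] at h
    refine h.congr' ?_
    filter_upwards [hr.eventually_lt_const one_pos] with k hk
    have hlt : ‖r k • x‖ < 1 := by
      rw [norm_smul, Real.norm_of_nonneg (hr0 k).le]
      nlinarith [norm_nonneg x, hr0 k]
    rw [(hasGradientAt_rescale (hr0 k) (hu.1 _ (by simpa using hlt))).gradient, hw _ hlt, flow,
      neg_neg, Real.exp_neg, Real.exp_log (hr0 k)]

theorem norm_le_of_hasGradientAt {n : ℕ} {f : En n → ℝ} {g : En n → En n} {δ : ℝ}
    (hf : ∀ x, ‖x‖ ≤ 1 → HasGradientAt f (g x) x) (hg : ∀ x, ‖x‖ ≤ 1 → ‖g x‖ ≤ δ) (h0 : f 0 = 0)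
    {x : En n} (hx : ‖x‖ ≤ 1) : ‖f x‖ ≤ δ := by
  have hb : ∀ y ∈ closedBall (0 : En n) 1, ‖y‖ ≤ 1 := fun y hy => by simpa using hy
  have h := (convex_closedBall (0 : En n) 1).norm_image_sub_le_of_norm_hasFDerivWithin_le
    (f := f) (f' := fun y => InnerProductSpace.toDual ℝ (En n) (g y)) (C := δ)
    (fun y hy => (hf y (hb y hy)).hasFDerivAt.hasFDerivWithinAt)
    (fun y hy => by rw [LinearIsometryEquiv.norm_map]; exact hg y (hb y hy))
    (x := 0) (y := x) (by simp) (by simpa using hx)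
  rw [h0, sub_zero, sub_zero] at h
  have hδ : 0 ≤ δ := (norm_nonneg _).trans (hg x hx)
  exact h.trans (mul_le_of_le_one_right hδ hx)

/-- A function which is uniformly small on the sphere has a small projection to quadratic forms. -/
theorem norm_le_of_projection {n : ℕ} (hn : 0 < n) {c : ℝ} (hc : 0 < c)
    {D : En n →L[ℝ] En n}
    (hcoer : c * ‖D‖ ^ 2 ≤ ∫ x, (inner ℝ x (D x) : ℝ) ^ 2 ∂sphMeas n)
    {f : En n → ℝ} (hfc : ContinuousOn f (sphere 0 1)) {δ : ℝ} (hδ : 0 ≤ δ)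
    (hf : ∀ x, ‖x‖ = 1 → ‖f x‖ ≤ δ)
    (h : ∫ x, (f x - 1 / 2 * inner ℝ x (D x)) * (1 / 2 * inner ℝ x (D x)) ∂sphMeas n = 0) :
    ‖D‖ ≤ 2 * δ * sphArea n / c := by
  have := isFiniteMeasure_sphMeas hn
  have hq : Continuous fun x : En n => (inner ℝ x (D x) : ℝ) := continuous_id.inner D.continuous
  have hfm : AEStronglyMeasurable f (sphMeas n) :=
    hfc.aestronglyMeasurable isClosed_sphere.measurableSet
  have i1 : Integrable (fun x => f x * (inner ℝ x (D x) : ℝ)) (sphMeas n) := by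
    refine Integrable.of_bound (hfm.mul hq.aestronglyMeasurable) (δ * ‖D‖) ?_
    filter_upwards [ae_sphMeas] with x hx
    rw [norm_mul]
    exact mul_le_mul (hf x hx) (norm_inner_clm_le D hx) (norm_nonneg _) hδ
  have i2 : Integrable (fun x => (inner ℝ x (D x) : ℝ) ^ 2) (sphMeas n) := by
    refine Integrable.of_bound (hq.pow 2).aestronglyMeasurable (‖D‖ ^ 2) ?_
    filter_upwards [ae_sphMeas] with x hx
    rw [norm_pow]
    exact pow_le_pow_left₀ (norm_nonneg _) (norm_inner_clm_le D hx) 2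
  have e : ∀ x : En n, (f x - 1 / 2 * inner ℝ x (D x)) * (1 / 2 * inner ℝ x (D x)) =
      1 / 2 * (f x * inner ℝ x (D x)) - 1 / 4 * (inner ℝ x (D x)) ^ 2 := fun x => by ring
  simp only [e] at h
  rw [integral_sub (i1.const_mul _) (i2.const_mul _), integral_const_mul, integral_const_mul] at h
  have hle : ∫ x, f x * (inner ℝ x (D x) : ℝ) ∂sphMeas n ≤ δ * ‖D‖ * sphArea n := by
    refine (Real.le_norm_self _).trans (norm_integral_le_of_norm_le_const ?_)
    filter_upwards [ae_sphMeas] with x hx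
    rw [norm_mul]
    exact mul_le_mul (hf x hx) (norm_inner_clm_le D hx) (norm_nonneg _) hδ
  have h1 : c * ‖D‖ ^ 2 ≤ 2 * (δ * ‖D‖ * sphArea n) := by linarith
  have hσ : 0 ≤ sphArea n := ENNReal.toReal_nonneg
  rcases (norm_nonneg D).eq_or_lt with h2 | h2
  · rw [← h2]; positivity
  · rw [le_div_iff₀ hc]
    refine le_of_mul_le_mul_left ?_ h2
    linarith

theorem exists_norm_gradient_Rt_le {n : ℕ} (hn : 0 < n) : ∃ C : ℝ, 0 < C ∧
    ∀ (u : En n → ℝ) (w : En n → En n) (B : ℝ → Matrix (Fin n) (Fin n) ℝ) (t ε : ℝ)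
    (A : En n →L[ℝ] En n), SolutionHyp u → (∀ x, ‖x‖ < 1 → gradient u x = w x) → BProp u B →
    0 < t → (∀ a b, inner ℝ (A a) b = inner ℝ a (A b)) →
    |LinearMap.trace ℝ (En n) (A : En n →ₗ[ℝ] En n) - 1| ≤ ε →
    (∀ x, ‖x‖ ≤ 1 → ‖flow w t x - A x‖ ≤ ε) →
    ∀ x, ‖x‖ ≤ 1 → ‖gradient (Rt u B t) x‖ ≤ C * ε := by
  obtain ⟨c, hc, hcoer⟩ := exists_coercive hn
  have hσ : 0 ≤ sphArea n := ENNReal.toReal_nonneg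
  refine ⟨2 + 4 * sphArea n / c, by positivity, fun u w B t ε A hu hw hB ht hA htr hlin x hx => ?_⟩
  have hε : 0 ≤ ε := (abs_nonneg _).trans htr
  obtain ⟨B', hB', hop⟩ := exists_matOp_eq hn hA
  obtain ⟨hBt, hproj⟩ := hB t ht
  set D := matOp (B t) - matOp B' with hD
  have hS : S0 (B t - B') :=
    ⟨hBt.1.sub hB'.1, by rw [Matrix.trace_sub, hBt.2, hB'.2, sub_zero]⟩
  set g : En n → En n := fun x => flow w t x - ((n : ℝ)⁻¹ • x + matOp B' x) with hg
  have hgrad : ∀ x, ‖x‖ ≤ 1 → HasGradientAt (fun x => ut u t x - qB B' x) (g x) x := fun x hx => by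
    have h := (hasGradientAt_ut hu hw ht hx).hasFDerivAt.sub (hasGradientAt_qB hB'.1 x).hasFDerivAt
    rw [← map_sub] at h
    exact hasGradientAt_iff_hasFDerivAt.2 h
  have hn1 : (1 : ℝ) ≤ n := by exact_mod_cast hn
  have hgb : ∀ x, ‖x‖ ≤ 1 → ‖g x‖ ≤ 2 * ε := fun x hx => by
    have e : g x = (flow w t x - A x) +
        ((LinearMap.trace ℝ (En n) (A : En n →ₗ[ℝ] En n) - 1) / n) • x := by
      rw [hg]
      simp only [hop]
      rw [sub_div, sub_smul, one_div]
      abel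
    have h2 : ‖((LinearMap.trace ℝ (En n) (A : En n →ₗ[ℝ] En n) - 1) / n) • x‖ ≤ ε := by
      rw [norm_smul, Real.norm_eq_abs, abs_div, Nat.abs_cast]
      refine (mul_le_of_le_one_right (by positivity) hx).trans ?_
      exact (div_le_self (abs_nonneg _) hn1).trans htr
    rw [e]
    refine (norm_add_le _ _).trans ?_
    linarith [hlin x hx]
  have hDle : ‖D‖ ≤ 2 * (2 * ε) * sphArea n / c := by
    refine norm_le_of_projection hn hc (hcoer D fun a b => ?_) (f := fun x => ut u t x - qB B' x)
      (fun y hy => ?_) (by positivity) (fun y hy => ?_) ?_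
    · rw [hD, ← matOp_sub]
      exact matOp_symm hS.1 a b
    · have hy1 : ‖y‖ = 1 := by simpa using hy
      exact (hgrad y hy1.le).hasFDerivAt.continuousAt.continuousWithinAt
    · refine norm_le_of_hasGradientAt hgrad hgb ?_ hy.le
      simp [ut, qB, p0, psiM]
    · rw [← hproj _ hS]
      refine integral_congr_ae (Eventually.of_forall fun y => ?_)
      simp only [psiM_eq, qB, hD, matOp_sub, _root_.sub_apply, inner_sub_right]
      ring
  have hR : HasGradientAt (Rt u B t) (g x - D x) x := by
    have h := (hasGradientAt_ut hu hw ht hx).hasFDerivAt.sub (hasGradientAt_qB hBt.1 x).hasFDerivAt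
    rw [← map_sub] at h
    have e : g x - D x = flow w t x - ((n : ℝ)⁻¹ • x + matOp (B t) x) := by
      have e1 : D x = matOp (B t) x - matOp B' x := rfl
      have e2 : g x = flow w t x - ((n : ℝ)⁻¹ • x + matOp B' x) := rfl
      rw [e1, e2, sub_sub, add_assoc, add_sub_cancel]
    rw [e]
    exact hasGradientAt_iff_hasFDerivAt.2 h
  rw [hR.gradient]
  refine (norm_sub_le _ _).trans ?_
  have h1 : ‖D x‖ ≤ ‖D‖ := (D.le_opNorm x).trans (mul_le_of_le_one_right (norm_nonneg _) hx)
  calc ‖g x‖ + ‖D x‖ ≤ 2 * ε + 2 * (2 * ε) * sphArea n / c := add_le_add (hgb x hx) (h1.trans hDle)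
    _ = _ := by ring

/-- ε(t) → 0 as t → ∞ at a singular point. -/
theorem stmt_10 (n : ℕ) (hn : 2 ≤ n) (u : En n → ℝ) (hu : SolutionHyp u)
    (hsing : IsSingular u)
    (B : ℝ → Matrix (Fin n) (Fin n) ℝ) (hB : BProp u B) :
    Tendsto (fun t => epsd u B t) atTop (nhds 0) := by
  have hn0 : 0 < n := by omega
  obtain ⟨K, w, hwF, hw⟩ := hu.exists_freeBdryField
  obtain ⟨C, hC, hbound⟩ := exists_norm_gradient_Rt_le hn0
  have hz := tendsto_zeroMass_of_singular hn0 hu hsing hwF hw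
  refine Metric.tendsto_nhds.2 fun η hη => ?_
  filter_upwards [eventually_near_linear hn0 hwF hz (ε := η / (2 * C)) (by positivity),
    eventually_gt_atTop 0] with t ht ht0
  obtain ⟨A, hA, htr, hlin⟩ := ht
  have hle : epsd u B t ≤ η / 2 := by
    refine Real.iSup_le (fun x => Real.iSup_le (fun hx => ?_) (by positivity)) (by positivity)
    refine (hbound u w B t _ A hu hw hB ht0 hA htr hlin x hx.2).trans_eq ?_
    field_simp
  have h0 : 0 ≤ epsd u B t :=
    Real.iSup_nonneg fun x => Real.iSup_nonneg fun _ => norm_nonneg _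
  rw [Real.dist_eq, sub_zero, abs_of_nonneg h0]
  linarith

end
end

section
/- Let u be a solution of the free boundary equation with the origin a singular point, and let A₀ be the unique symmetric matrix with trace(A₀) = 1 such that the rescalings (u(rx) − u(0))/r² converge to q∞(x) := (1/2) x·A₀x in C¹ locally uniformly as r ↓ 0. Then u admits the second-order Taylor expansion u(x) − u(0) = (1/2) x·A₀x + o(|x|²) as x → 0; that is, (u(x) − u(0) − (1/2) x·A₀x)/|x|² → 0 as x → 0, x ≠ 0. -/
open MeasureTheory Metric Filter Topology Pointwise

noncomputable section

/-- the second-order Taylor expansion u(x) − u(0) = (1/2)x·A₀x + o(|x|²). -/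
theorem stmt_19 (n : ℕ) (hn : 2 ≤ n) (u : En n → ℝ) (hu : SolutionHyp u)
    (hsing : IsSingular u)
    (A₀ : Matrix (Fin n) (Fin n) ℝ) (hsymm : A₀.IsSymm) (htr : A₀.trace = 1)
    (hconv : ∀ K : Set (En n), IsCompact K →
      TendstoUniformlyOn (fun (r : ℝ) (x : En n) => (u (r • x) - u 0) / r^2)
        (fun x => (1/2) * ∑ i, ∑ j, A₀ i j * x i * x j)
        (nhdsWithin (0:ℝ) (Set.Ioi 0)) K ∧
      TendstoUniformlyOn
        (fun (r : ℝ) (x : En n) => gradient (fun y => (u (r • y) - u 0) / r^2) x)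
        (fun x => gradient (fun y => (1/2) * ∑ i, ∑ j, A₀ i j * y i * y j) x)
        (nhdsWithin (0:ℝ) (Set.Ioi 0)) K) :
    Tendsto
      (fun x : En n => (u x - u 0 - (1/2) * ∑ i, ∑ j, A₀ i j * x i * x j) / ‖x‖^2)
      (nhdsWithin (0:En n) {x | x ≠ 0}) (nhds 0) := by
  have hsphere := (hconv (sphere 0 1) (isCompact_sphere 0 1)).1
  rw [Metric.tendstoUniformlyOn_iff] at hsphere
  have hnorm : Tendsto (fun x : En n => ‖x‖) (nhdsWithin 0 {x | x ≠ 0})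
      (nhdsWithin (0:ℝ) (Set.Ioi 0)) := tendsto_norm_nhdsNE_zero
  rw [Metric.tendsto_nhds]
  intro ε hε
  filter_upwards [hnorm.eventually (hsphere ε hε), self_mem_nhdsWithin] with x hx hx0
  have hpos : 0 < ‖x‖ := norm_pos_iff.mpr hx0
  have hunit : ‖x‖⁻¹ • x ∈ sphere (0:En n) 1 := by
    simp [norm_smul, hpos.ne']
  have hclose := hx _ hunit
  rw [smul_inv_smul₀ hpos.ne', dist_comm, Real.dist_eq] at hclose
  have hhom : ∑ i, ∑ j, A₀ i j * (‖x‖⁻¹ • x) i * (‖x‖⁻¹ • x) j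
      = (∑ i, ∑ j, A₀ i j * x i * x j) / ‖x‖ ^ 2 := by
    simp only [Finset.sum_div, PiLp.smul_apply, smul_eq_mul]
    refine Finset.sum_congr rfl fun i _ => Finset.sum_congr rfl fun j _ => ?_
    field_simp
  rw [hhom, ← mul_div_assoc, ← sub_div] at hclose
  rwa [Real.dist_eq, sub_zero]

end
end
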